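/- There is no s.p.i.m.f. subgroup G ≤ Sp_8(ℚ) whose Fitting subgroup is isomorphic to the quaternion group Q_8; that is, there is no s.p.i.m.f. G ≤ Sp_8(ℚ) possessing a normal nilpotent subgroup N isomorphic to Q_8 that contains every normal nilpotent subgroup of G. -/

import Mathlib

open Matrix
open scoped MatrixGroups

/-- `G ≤ GL_{2n}(ℚ)` (rows/columns indexed by `Fin n ⊕ Fin n`) is symplectic if it fixes
some invertible skew-symmetric form. -/
def IsSymplecticGroup {n : ℕ} (G : Subgroup (GL (Fin n ⊕ Fin n) ℚ)) : Prop :=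
  ∃ A : Matrix (Fin n ⊕ Fin n) (Fin n ⊕ Fin n) ℚ, Aᵀ = -A ∧ IsUnit A ∧
    ∀ g ∈ G, (g : Matrix (Fin n ⊕ Fin n) (Fin n ⊕ Fin n) ℚ) * A *
      (g : Matrix (Fin n ⊕ Fin n) (Fin n ⊕ Fin n) ℚ)ᵀ = A

/-- A `ℚ`-subspace of the natural (right) module `ℚ^{1×2n}` invariant under `G`. -/
def IsInvariantSubspace {n : ℕ} (G : Subgroup (GL (Fin n ⊕ Fin n) ℚ))
    (W : Submodule ℚ (Fin n ⊕ Fin n → ℚ)) : Prop :=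
  ∀ g ∈ G, ∀ v ∈ W, v ᵥ* (g : Matrix (Fin n ⊕ Fin n) (Fin n ⊕ Fin n) ℚ) ∈ W

/-- `G` is rationally irreducible. -/
def IsRatIrreducible {n : ℕ} (G : Subgroup (GL (Fin n ⊕ Fin n) ℚ)) : Prop :=
  ∀ W : Submodule ℚ (Fin n ⊕ Fin n → ℚ), IsInvariantSubspace G W → W = ⊥ ∨ W = ⊤

/-- `G ≤ GL_{2n}(ℚ)` is symplectic imprimitive: `G` is conjugate in `GL_{2n}(ℚ)` to a
subgroup of a wreath product `H ≀ S_k` (`k ≥ 2`, `n = d·k`) where `H ≤ GL_{2d}(ℚ)` is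
the (symplectic) stabilizer of an invertible skew-symmetric form `A`, the base group
acting blockwise on `(ℚ^{1×2d})^k` and `S_k` permuting the blocks. -/
def IsSympImprimitive {n : ℕ} (G : Subgroup (GL (Fin n ⊕ Fin n) ℚ)) : Prop :=
  ∃ (d k : ℕ), n = d * k ∧ 2 ≤ k ∧
    ∃ (e : Fin k × Fin (2 * d) ≃ (Fin n ⊕ Fin n))
      (A : Matrix (Fin (2 * d)) (Fin (2 * d)) ℚ) (T : GL (Fin n ⊕ Fin n) ℚ),
      Aᵀ = -A ∧ IsUnit A ∧
      ∀ g ∈ G, ∃ (σ : Equiv.Perm (Fin k)) (h : Fin k → Matrix (Fin (2 * d)) (Fin (2 * d)) ℚ),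
        (∀ i, h i * A * (h i)ᵀ = A) ∧
        ((T * g * T⁻¹ : GL (Fin n ⊕ Fin n) ℚ) : Matrix (Fin n ⊕ Fin n) (Fin n ⊕ Fin n) ℚ) =
          Matrix.reindex e e
            (Matrix.of fun p q : Fin k × Fin (2 * d) =>
              if σ p.1 = q.1 then h p.1 p.2 q.2 else 0)

/-- `G` is s.p.i.m.f.: finite, symplectic, rationally irreducible, symplectic primitive,
and maximal among finite symplectic subgroups of `GL_{2n}(ℚ)`. -/
def IsSPIMF {n : ℕ} (G : Subgroup (GL (Fin n ⊕ Fin n) ℚ)) : Prop :=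
  (G : Set (GL (Fin n ⊕ Fin n) ℚ)).Finite ∧ IsSymplecticGroup G ∧ IsRatIrreducible G ∧
    ¬ IsSympImprimitive G ∧
    ∀ H : Subgroup (GL (Fin n ⊕ Fin n) ℚ), (H : Set (GL (Fin n ⊕ Fin n) ℚ)).Finite →
      IsSymplecticGroup H → G ≤ H → H = G


/-- A finite set of rationals stable under `t ↦ t² - 2` consists of traces of
rational rotations. -/
theorem Rat.mem_of_finite_of_sq_sub_two_mem {S : Set ℚ} (hS : S.Finite)
    (h : ∀ t ∈ S, t ^ 2 - 2 ∈ S) {t : ℚ} (ht : t ∈ S) :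
    t = 0 ∨ t = 1 ∨ t = -1 ∨ t = 2 ∨ t = -2 := by
  obtain ⟨m, hm, hmax⟩ := Set.exists_max_image S (fun t => |t|) hS ⟨t, ht⟩
  obtain ⟨d, hd, hdmax⟩ := Set.exists_max_image S (fun t => t.den) hS ⟨t, ht⟩
  have hm2 : |m| ≤ 2 := by
    have h1 := (le_abs_self _).trans (hmax _ (h m hm))
    rw [← sq_abs] at h1
    nlinarith [abs_nonneg m]
  have hden : ∀ x : ℚ, (x ^ 2 - 2).den = x.den ^ 2 := by
    intro x
    have := Rat.sub_intCast_den (x ^ 2) 2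
    simp [Rat.den_pow]
  have hd1 : d.den = 1 := by
    have h1 := hdmax _ (h d hd)
    rw [hden] at h1
    have := d.den_pos
    nlinarith
  have htd : t.den = 1 := by
    have h1 := hdmax _ ht
    have := t.den_pos
    omega
  have htm : |t| ≤ 2 := (hmax _ ht).trans hm2
  obtain ⟨n, rfl⟩ : ∃ n : ℤ, t = n := ⟨t.num, ((Rat.den_eq_one_iff t).1 htd).symm⟩
  have hn : |n| ≤ 2 := by exact_mod_cast htm
  have hn' := abs_le.1 hn
  obtain ⟨h1, h2⟩ := hn'
  interval_cases n <;> simp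

theorem Equiv.Perm.isSolvable_of_card_le_three {α : Type*} [Finite α] (h : Nat.card α ≤ 3) :
    Group.IsSolvable (Equiv.Perm α) := by
  have h3 : Group.IsSolvable (Equiv.Perm (Fin 3)) := by
    have hc : Nat.card (alternatingGroup (Fin 3)) = 3 := by
      rw [nat_card_alternatingGroup]; simp [Nat.factorial]
    have : Fact (Nat.Prime 3) := ⟨by norm_num⟩
    have : IsCyclic (alternatingGroup (Fin 3)) := isCyclic_of_prime_card hc
    have : Group.IsSolvable (alternatingGroup (Fin 3)) := inferInstance
    refine Group.isSolvable_of_ker_le_range (alternatingGroup (Fin 3)).subtype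
      (Equiv.Perm.sign (α := Fin 3)) ?_
    intro x hx
    exact ⟨⟨x, hx⟩, rfl⟩
  have := Fintype.ofFinite α
  obtain ⟨f⟩ : Nonempty (α ↪ Fin 3) := by
    apply Function.Embedding.nonempty_of_card_le
    simpa [Nat.card_eq_fintype_card] using h
  exact Group.isSolvable_of_isSolvable_injective (Equiv.Perm.viaEmbeddingHom_injective f)

theorem MonoidHom.map_mul_map_inv_eq_one {D R : Type*} [Group D] [Monoid R]
    (f : D →* R) (g : D) : f g * f g⁻¹ = 1 := by
  rw [← map_mul, mul_inv_cancel, map_one]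

section RationalTraces

variable {D R : Type*} [Group D] [Ring R] [Algebra ℚ R] {f : D →* R} {t : D → ℚ}

theorem map_inv_eq_of_add_inv (ht : ∀ g, f g + f g⁻¹ = t g • (1 : R)) (g : D) :
    f g⁻¹ = t g • 1 - f g := by
  rw [← ht g]; abel

theorem map_mul_self_eq_of_add_inv (ht : ∀ g, f g + f g⁻¹ = t g • (1 : R)) (g : D) :
    f g * f g = t g • f g - 1 := by
  have h := f.map_mul_map_inv_eq_one g
  rw [map_inv_eq_of_add_inv ht g, mul_sub, mul_smul_comm, mul_one] at h
  rw [← h]; abel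

variable [Nontrivial R]

theorem rat_smul_one_injective : Function.Injective fun r : ℚ => r • (1 : R) := by
  simpa [Algebra.smul_def] using (algebraMap ℚ R).injective

theorem trace_conj_of_add_inv (ht : ∀ g, f g + f g⁻¹ = t g • (1 : R)) (g h : D) :
    t (g * h * g⁻¹) = t h := by
  apply rat_smul_one_injective (R := R)
  have h1 : (g * h * g⁻¹)⁻¹ = g * h⁻¹ * g⁻¹ := by group
  simp only
  rw [← ht, h1]
  simp only [map_mul]
  rw [← add_mul, ← mul_add, ht, mul_smul_comm, smul_mul_assoc, mul_one,
    f.map_mul_map_inv_eq_one]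

theorem trace_mul_self_of_add_inv (ht : ∀ g, f g + f g⁻¹ = t g • (1 : R)) (g : D) :
    t (g * g) = t g ^ 2 - 2 := by
  apply rat_smul_one_injective (R := R)
  simp only
  rw [← ht, _root_.mul_inv_rev, map_mul, map_mul, map_mul_self_eq_of_add_inv ht,
    map_inv_eq_of_add_inv ht]
  have := map_mul_self_eq_of_add_inv ht g
  simp only [sub_mul, mul_sub, smul_mul_assoc, mul_smul_comm, one_mul, mul_one, this]
  module

/-- An element commuting with a noncommuting pair of a group with rational traces is scalar. -/
theorem sum_eq_half_trace_of_commute (ht : ∀ g, f g + f g⁻¹ = t g • (1 : R)) {x y : D}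
    (hx : t x ^ 2 ≠ 4) (hxy : f x * f y ≠ f y * f x) {ι : Type*} (s : Finset ι) (u : ι → D)
    (hex : (∑ i ∈ s, f (u i)) * f x = f x * ∑ i ∈ s, f (u i))
    (hey : (∑ i ∈ s, f (u i)) * f y = f y * ∑ i ∈ s, f (u i)) :
    ∑ i ∈ s, f (u i) = ((∑ i ∈ s, t (u i)) / 2) • (1 : R) := by
  set e := ∑ i ∈ s, f (u i) with he
  set τ := ∑ i ∈ s, t (u i)
  set ρ := ∑ i ∈ s, t (u i * x⁻¹)
  have h1 : ∑ i ∈ s, f (u i)⁻¹ = τ • 1 - e := by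
    rw [Finset.sum_smul, he, ← Finset.sum_sub_distrib]
    exact Finset.sum_congr rfl fun i _ => map_inv_eq_of_add_inv ht _
  have h2 : e * f x⁻¹ + f x * (τ • 1 - e) = ρ • 1 := by
    rw [← h1, he, Finset.sum_mul, Finset.mul_sum, Finset.sum_smul, ← Finset.sum_add_distrib]
    refine Finset.sum_congr rfl fun i _ => ?_
    rw [← ht, _root_.mul_inv_rev, inv_inv, map_mul, map_mul]
  have hxx := map_mul_self_eq_of_add_inv ht x
  rw [map_inv_eq_of_add_inv ht, mul_sub, mul_sub, mul_smul_comm, mul_smul_comm, mul_one, mul_one,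
    hex] at h2
  have h3 : t x • e - (2 : ℚ) • (f x * e) = ρ • 1 - τ • f x := by
    rw [← h2]; module
  have h4 : (t x • 1 - (2 : ℚ) • f x) * (t x • e - (2 : ℚ) • (f x * e)) =
      (t x ^ 2 - 4) • e := by
    simp only [sub_mul, mul_sub, smul_mul_assoc, mul_smul_comm, one_mul, ← mul_assoc, hxx]
    module
  have h5 : (t x ^ 2 - 4) • e = (ρ * t x - 2 * τ) • 1 + (τ * t x - 2 * ρ) • f x := by
    rw [← h4, h3]
    simp only [sub_mul, mul_sub, smul_mul_assoc, mul_smul_comm, one_mul, mul_one, hxx]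
    module
  have h6 : (τ * t x - 2 * ρ) • (f x * f y - f y * f x) = 0 := by
    have h7 : (t x ^ 2 - 4) • (e * f y - f y * e) = 0 := by rw [hey, sub_self, smul_zero]
    rw [smul_sub, ← smul_mul_assoc, ← mul_smul_comm, h5] at h7
    rw [← h7]
    simp only [add_mul, mul_add, smul_mul_assoc, mul_smul_comm, one_mul, mul_one]
    module
  have h8 : τ * t x - 2 * ρ = 0 := by
    rcases smul_eq_zero.1 h6 with h | h
    · exact h
    · exact absurd (sub_eq_zero.1 h) hxy
  have h9 : t x ^ 2 - 4 ≠ 0 := sub_ne_zero.2 hx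
  have h10 : ρ * t x - 2 * τ = (t x ^ 2 - 4) * (τ / 2) := by linear_combination (-t x / 2) * h8
  rw [h8, zero_smul, add_zero, h10, mul_smul] at h5
  exact smul_right_injective R h9 h5

variable [Finite D]

theorem trace_mem_of_add_inv (ht : ∀ g, f g + f g⁻¹ = t g • (1 : R)) (g : D) :
    t g = 0 ∨ t g = 1 ∨ t g = -1 ∨ t g = 2 ∨ t g = -2 :=
  Rat.mem_of_finite_of_sq_sub_two_mem (Set.finite_range t)
    (by rintro _ ⟨g, rfl⟩; exact ⟨g * g, trace_mul_self_of_add_inv ht g⟩) ⟨g, rfl⟩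

theorem map_eq_one_of_trace_eq_two (ht : ∀ g, f g + f g⁻¹ = t g • (1 : R)) {g : D}
    (hg : t g = 2) : f g = 1 := by
  have hsq := map_mul_self_eq_of_add_inv ht g
  have hpow : ∀ n : ℕ, f g ^ n = 1 + (n : ℚ) • (f g - 1) := by
    intro n
    induction n with
    | zero => simp
    | succ n ih =>
      rw [pow_succ, ih]
      simp only [add_mul, smul_mul_assoc, sub_mul, one_mul, hsq, hg, Nat.cast_succ]
      module
  have h1 := hpow (orderOf g)
  rw [← map_pow, pow_orderOf_eq_one, map_one, left_eq_add] at h1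
  rcases smul_eq_zero.1 h1 with h | h
  · exact absurd h (by exact_mod_cast (orderOf_pos g).ne')
  · exact sub_eq_zero.1 h

theorem map_eq_neg_one_of_trace_eq_neg_two (ht : ∀ g, f g + f g⁻¹ = t g • (1 : R)) {g : D}
    (hg : t g = -2) : f g = -1 := by
  have h1 : f (g * g) = 1 :=
    map_eq_one_of_trace_eq_two ht (by rw [trace_mul_self_of_add_inv ht, hg]; norm_num)
  rw [map_mul, map_mul_self_eq_of_add_inv ht, hg] at h1
  have h2 : (-2 : ℚ) • f g = (-2 : ℚ) • (-1 : R) := by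
    rw [sub_eq_iff_eq_add] at h1; rw [h1]; module
  exact smul_right_injective R (by norm_num : (-2 : ℚ) ≠ 0) h2

/-- The row orthogonality relation for the trace of a noncommutative group with rational traces. -/
theorem sum_trace_sq_eq_card_of_add_inv [Fintype D] (hf : Function.Injective f)
    (ht : ∀ g, f g + f g⁻¹ = t g • (1 : R)) {x y : D} (hxy : x * y ≠ y * x) :
    ∑ g, t g ^ 2 = (Fintype.card D : ℚ) := by
  have hfxy : f x * f y ≠ f y * f x := by
    rw [← map_mul, ← map_mul]; exact hf.ne hxy
  have hx : t x ^ 2 ≠ 4 := by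
    intro h
    have h4 : (t x - 2) * (t x + 2) = 0 := by linear_combination h
    rcases mul_eq_zero.1 h4 with h | h
    · exact hfxy (by rw [map_eq_one_of_trace_eq_two ht (sub_eq_zero.1 h)]; simp)
    · exact hfxy (by
        rw [map_eq_neg_one_of_trace_eq_neg_two ht (eq_neg_of_add_eq_zero_left h)]; simp)
  have hconj : ∀ (u : D → D), (∀ w, ∃ e : D ≃ D, ∀ g, w * u g = u (e g) * w) →
      ∑ g, f (u g) = ((∑ g, t (u g)) / 2) • (1 : R) := by
    intro u hu
    have key : ∀ w, (∑ g, f (u g)) * f w = f w * ∑ g, f (u g) := by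
      intro w
      obtain ⟨e, he⟩ := hu w
      rw [Finset.sum_mul, Finset.mul_sum, ← e.sum_comp]
      exact Finset.sum_congr rfl fun g _ => by rw [← map_mul, ← map_mul, he]
    exact sum_eq_half_trace_of_commute ht hx hfxy _ u (key x) (key y)
  set n : ℚ := (Fintype.card D : ℚ) with hn
  set T := ∑ g, t g ^ 2 with hT
  have hs : ∑ g, f (g * g) = ((T - 2 * n) / 2) • (1 : R) := by
    rw [hconj (fun g => g * g) fun w => ⟨(MulAut.conj w).toEquiv, fun g => by
      simp [MulAut.conj_apply, mul_assoc]⟩]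
    congr 2
    rw [Finset.sum_congr rfl fun g _ => trace_mul_self_of_add_inv ht g, Finset.sum_sub_distrib]
    simp [hn, hT, mul_comm]
  have hφ : ∀ h, ∑ g, f (g * h * g⁻¹) = (n * t h / 2) • (1 : R) := by
    intro h
    rw [hconj (fun g => g * h * g⁻¹) fun w => ⟨Equiv.mulLeft w, fun g => by simp [mul_assoc]⟩]
    congr 2
    rw [Finset.sum_congr rfl fun g _ => trace_conj_of_add_inv ht g h]
    simp [hn]
  have h1 : ∑ h, (∑ g, f (g * h * g⁻¹)) * f h = (n * ((T - 2 * n) / 2 + n) / 2) • (1 : R) := by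
    have h2 : ∀ h, (∑ g, f (g * h * g⁻¹)) * f h = (n / 2) • (f (h * h) + 1) := by
      intro h
      rw [hφ, map_mul, map_mul_self_eq_of_add_inv ht, smul_mul_assoc, one_mul]
      module
    rw [Finset.sum_congr rfl fun h _ => h2 h, ← Finset.smul_sum, Finset.sum_add_distrib, hs]
    simp only [Finset.sum_const, Finset.card_univ, ← Nat.cast_smul_eq_nsmul ℚ, ← hn]
    module
  have h3 : ∑ h, (∑ g, f (g * h * g⁻¹)) * f h = (∑ g, f (g * g)) * ∑ g, f (g * g) := by
    simp_rw [Finset.sum_mul]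
    rw [Finset.sum_comm]
    have h4 : ∀ g, ∑ h, f (g * h * g⁻¹) * f h = ∑ k, f (g * (k * k) * g) := by
      intro g
      rw [← Equiv.sum_comp (Equiv.mulRight g)]
      exact Finset.sum_congr rfl fun k _ => by rw [← map_mul]; simp [mul_assoc]
    rw [Finset.sum_congr rfl fun g _ => h4 g, Finset.sum_comm]
    have h5 : ∀ k, ∑ g, f (g * (k * k) * g) = ∑ u, f (u * u) * f (k⁻¹ * k⁻¹) := by
      intro k
      rw [← Equiv.sum_comp (Equiv.mulRight (k * k)⁻¹)]
      exact Finset.sum_congr rfl fun u _ => by rw [← map_mul]; simp [mul_assoc]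
    rw [Finset.sum_congr rfl fun k _ => h5 k, ← Equiv.sum_comp (Equiv.inv D)]
    simp_rw [← Finset.sum_mul, ← Finset.mul_sum]
    simp
  rw [h1, hs, smul_mul_assoc, one_mul, smul_smul] at h3
  have h6 := rat_smul_one_injective h3
  have h7 : (T - 4 * n) * (T - n) = 0 := by linear_combination (-4) * h6
  rcases mul_eq_zero.1 h7 with h | h
  · exfalso
    have h8 : ∑ g, (4 - t g ^ 2) = 0 := by
      rw [Finset.sum_sub_distrib, ← hT]
      simp only [Finset.sum_const, Finset.card_univ, nsmul_eq_mul, ← hn]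
      linear_combination -h
    have h9 : ∀ g ∈ Finset.univ, 0 ≤ 4 - t g ^ 2 := by
      intro g _
      rcases trace_mem_of_add_inv ht g with h | h | h | h | h <;> rw [h] <;> norm_num
    have := (Finset.sum_eq_zero_iff_of_nonneg h9).1 h8 x (Finset.mem_univ x)
    exact hx (by linear_combination -this)
  · linear_combination h

theorem isSolvable_of_commutator_mem_center {G : Type*} [Group G]
    (h : ∀ a b c : G, Commute (a * b * a⁻¹ * b⁻¹) c) : Group.IsSolvable G := by
  have : Group.IsSolvable (Subgroup.center G) :=
    Group.isSolvable_of_comm fun a b => Subtype.ext (Subgroup.mem_center_iff.1 b.2 a)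
  refine Group.isSolvable_of_ker_le_range (Subgroup.center G).subtype
    (Abelianization.of (G := G)) ?_
  rw [Abelianization.ker_of, Subgroup.range_subtype, commutator_def, Subgroup.commutator_le]
  intro a _ b _
  rw [Subgroup.mem_center_iff]
  intro c
  exact (h a b c).symm

theorem commute_mul_inv_of_twisted {G : Type*} [Group G] {z w g h : G} (hz : ∀ c, Commute z c)
    (h₁ : g * h * w = z * w * (g * h)) (h₂ : h * g * w = z * w * (h * g)) :
    Commute (g * h * g⁻¹ * h⁻¹) w := by
  have h₃ : g * h * g⁻¹ * h⁻¹ = g * h * (h * g)⁻¹ := by group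
  have h₄ : (h * g)⁻¹ * (z * w) = w * (h * g)⁻¹ := by
    rw [inv_mul_eq_iff_eq_mul, ← mul_assoc, h₂, mul_inv_cancel_right]
  rw [Commute, SemiconjBy, h₃, ← mul_assoc w, ← mul_right_inj z]
  calc z * (g * h * (h * g)⁻¹ * w) = g * h * ((h * g)⁻¹ * (z * w)) := by
        rw [← mul_assoc z, ← mul_assoc z, (hz _).eq]; simp only [mul_assoc, (hz _).eq]
    _ = z * (w * (g * h) * (h * g)⁻¹) := by
        rw [h₄, ← mul_assoc, h₁]; simp only [mul_assoc]

/-- A finite group of units with rational reduced traces is solvable. -/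
theorem isSolvable_of_add_inv_rational (hf : Function.Injective f)
    (ht : ∀ g, f g + f g⁻¹ = t g • (1 : R)) : Group.IsSolvable D := by
  classical
  by_cases hcomm : ∀ x y : D, x * y = y * x
  · exact Group.isSolvable_of_comm hcomm
  push Not at hcomm
  obtain ⟨x, y, hxy⟩ := hcomm
  have := Fintype.ofFinite D
  have hsum := sum_trace_sq_eq_card_of_add_inv hf ht hxy
  set Ω : Finset D := Finset.univ.filter fun g => t g = 0 with hΩ
  set E : Finset D := Finset.univ.filter fun g => t g = 2 ∨ t g = -2 with hE
  have hmΩ : ∀ g, g ∈ Ω ↔ t g = 0 := fun g => by simp [hΩ]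
  have hcard : Ω.card = 3 * E.card := by
    have h1 : ∑ g, (t g ^ 2 - 1) = 0 := by
      rw [Finset.sum_sub_distrib, hsum]; simp
    have h2 : ∀ g, t g ^ 2 - 1 =
        3 * (if t g = 2 ∨ t g = -2 then 1 else 0) - (if t g = 0 then 1 else 0) := by
      intro g
      rcases trace_mem_of_add_inv ht g with h | h | h | h | h <;> rw [h] <;> norm_num
    rw [Finset.sum_congr rfl fun g _ => h2 g, Finset.sum_sub_distrib, ← Finset.mul_sum,
      Finset.sum_boole, Finset.sum_boole, ← hΩ, ← hE, sub_eq_zero] at h1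
    exact_mod_cast h1.symm
  have hE1 : 1 ≤ E.card := by
    refine Finset.card_pos.2 ⟨1, ?_⟩
    have h1 : t 1 = 2 := by
      apply rat_smul_one_injective (R := R)
      simp only
      rw [← ht, inv_one, map_one]; module
    simp [hE, h1]
  have hE2 : E.card ≤ 2 := by
    have h1 : E.image f ⊆ {1, -1} := by
      intro r hr
      obtain ⟨g, hg, rfl⟩ := Finset.mem_image.1 hr
      rcases (Finset.mem_filter.1 hg).2 with h | h
      · simp [map_eq_one_of_trace_eq_two ht h]
      · simp [map_eq_neg_one_of_trace_eq_neg_two ht h]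
    rw [← Finset.card_image_of_injective E hf]
    exact (Finset.card_le_card h1).trans Finset.card_le_two
  have hinv : ∀ g ∈ Ω, f g⁻¹ = - f g := by
    intro g hg
    rw [map_inv_eq_of_add_inv ht, (hmΩ g).1 hg, zero_smul, zero_sub]
  have hne : ∀ g ∈ Ω, g⁻¹ ≠ g := by
    intro g hg h
    have h1 := hinv g hg
    have h2 := f.map_mul_map_inv_eq_one g
    rw [h] at h1 h2
    have h3 : f g = 0 := by
      have : (2 : ℚ) • f g = 0 := by rw [two_smul]; nth_rw 2 [h1]; simp
      exact (smul_eq_zero.1 this).resolve_left (by norm_num)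
    rw [h3, zero_mul] at h2
    exact zero_ne_one h2
  have hΩinv : ∀ g ∈ Ω, g⁻¹ ∈ Ω := by
    intro g hg
    rw [hmΩ]
    apply rat_smul_one_injective (R := R)
    simp only
    rw [← ht, inv_inv, add_comm, ht, (hmΩ g).1 hg]
  have hneg : ∀ a ∈ Ω, ∀ b ∈ Ω, a * b = b * a → b = a ∨ b = a⁻¹ := by
    intro a ha b hb hab
    have hsqa := map_mul_self_eq_of_add_inv ht a
    have hsqb := map_mul_self_eq_of_add_inv ht b
    rw [(hmΩ _).1 ha, zero_smul, zero_sub] at hsqa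
    rw [(hmΩ _).1 hb, zero_smul, zero_sub] at hsqb
    have h1 : f (a * b) * f (a * b) = 1 := by
      have : (a * b) * (a * b) = (a * a) * (b * b) := by
        rw [mul_assoc, ← mul_assoc b, ← hab]; simp only [mul_assoc]
      rw [← map_mul, this]; simp [hsqa, hsqb]
    have h2 := f.map_mul_map_inv_eq_one (a * b)
    have h3 : f (a * b) = f (a * b)⁻¹ := by
      have h4 := congrArg (f (a * b) * ·) h2
      simp only [← mul_assoc, h1, mul_one, one_mul] at h4
      exact h4.symm
    have h5 := ht (a * b)
    rw [← h3] at h5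
    have h6 := map_mul_self_eq_of_add_inv ht (a * b)
    have h7 : t (a * b) = 2 ∨ t (a * b) = -2 := by
      have h8 : f (a * b) = (t (a * b) / 2) • (1 : R) := by
        have : (2 : ℚ) • f (a * b) = (2 : ℚ) • ((t (a * b) / 2) • (1 : R)) := by
          rw [two_smul, h5]; module
        exact smul_right_injective R (by norm_num : (2 : ℚ) ≠ 0) this
      rw [h8, smul_mul_smul_comm, one_mul] at h1
      have h9 : (t (a * b) / 2 * (t (a * b) / 2)) • (1 : R) = (1 : ℚ) • 1 := by rw [h1, one_smul]
      have h10 := rat_smul_one_injective h9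
      have h11 : (t (a * b) - 2) * (t (a * b) + 2) = 0 := by linear_combination 4 * h10
      rcases mul_eq_zero.1 h11 with h | h
      · exact Or.inl (sub_eq_zero.1 h)
      · exact Or.inr (eq_neg_of_add_eq_zero_left h)
    rcases h7 with h | h
    · right
      have := hf ((map_eq_one_of_trace_eq_two ht h).trans (map_one f).symm)
      exact (inv_eq_of_mul_eq_one_right this).symm
    · left
      have h8 := map_eq_neg_one_of_trace_eq_neg_two ht h
      apply hf
      have h9 : f a * f (a * b) = - f b := by
        rw [map_mul, ← mul_assoc, hsqa]; simp
      rw [h8] at h9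
      simpa using h9.symm
  obtain ⟨a, ha⟩ : ∃ a, a ∈ Ω := Finset.card_pos.1 (by omega)
  obtain ⟨b, hb, hba, hba'⟩ : ∃ b ∈ Ω, b ≠ a ∧ b ≠ a⁻¹ := by
    by_contra! hcon
    have h1 : Ω ⊆ {a, a⁻¹} := by
      intro g hg
      by_cases h : g = a
      · simp [h]
      · simp [hcon g hg h]
    have := (Finset.card_le_card h1).trans Finset.card_le_two
    omega
  have hab : a * b ≠ b * a := fun h => (hneg a ha b hb h).elim hba hba'
  have hcentral : ∀ z : D, Commute z a → Commute z b → ∀ c, Commute z c := by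
    intro z hza hzb c
    have hz := sum_eq_half_trace_of_commute ht (x := a) (y := b)
      (by rw [(hmΩ _).1 ha]; norm_num) (by rw [← map_mul, ← map_mul]; exact hf.ne hab)
      {()} (fun _ => z) (by simpa using (hza.map f).eq) (by simpa using (hzb.map f).eq)
    rw [Finset.sum_singleton] at hz
    apply hf
    rw [map_mul, map_mul, hz]; simp
  set S : Finset (MulAut D) := Ω.image MulAut.conj with hS
  have hS3 : S.card ≤ 3 := by
    have h1 : 2 * S.card ≤ Ω.card := by
      refine Finset.mul_card_image_le_card Ω 2 ?_
      intro s hs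
      obtain ⟨g, hg, rfl⟩ := Finset.mem_image.1 hs
      have hsub : {g, g⁻¹} ⊆ Ω.filter fun h => MulAut.conj h = MulAut.conj g := by
        intro h hh
        rw [Finset.mem_insert, Finset.mem_singleton] at hh
        rcases hh with rfl | rfl
        · simp [hg]
        · rw [Finset.mem_filter]
          refine ⟨hΩinv g hg, ?_⟩
          ext w
          apply hf
          simp [MulAut.conj_apply, hinv g hg]
      rw [← Finset.card_pair (hne g hg).symm]
      exact Finset.card_le_card hsub
    omega
  have hstab : ∀ g : D, ∀ s : MulAut D, MulAut.conj (MulAut.conj g) s ∈ S ↔ s ∈ S := by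
    have h1 : ∀ g : D, ∀ s ∈ S, MulAut.conj (MulAut.conj g) s ∈ S := by
      intro g s hs
      obtain ⟨w, hw, rfl⟩ := Finset.mem_image.1 hs
      refine Finset.mem_image.2 ⟨g * w * g⁻¹, ?_, ?_⟩
      · rw [hmΩ, trace_conj_of_add_inv ht]; exact (hmΩ w).1 hw
      · simp [MulAut.conj_apply]
    intro g s
    refine ⟨fun h => ?_, h1 g s⟩
    have := h1 g⁻¹ _ h
    simpa [MulAut.conj_apply, mul_assoc] using this
  let ψ : D →* Equiv.Perm {s // s ∈ S} :=
    { toFun := fun g =>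
        Equiv.Perm.subtypePerm (MulEquiv.toEquiv (MulAut.conj (MulAut.conj g))) (hstab g)
      map_one' := by ext; simp
      map_mul' := fun g h => Equiv.ext fun s => Subtype.ext (by
        change MulAut.conj (MulAut.conj (g * h)) s.1 =
          MulAut.conj (MulAut.conj g) (MulAut.conj (MulAut.conj h) s.1)
        rw [map_mul, map_mul, MulAut.mul_apply]) }
  have : Group.IsSolvable (Equiv.Perm {s // s ∈ S}) :=
    Equiv.Perm.isSolvable_of_card_le_three (by simpa using hS3)
  have hker : ∀ g ∈ ψ.ker, ∀ w ∈ Ω, ∀ c, Commute (g * w * g⁻¹ * w⁻¹) c := by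
    intro g hg w hw c
    have hw' : MulAut.conj w ∈ S := Finset.mem_image_of_mem _ hw
    have h1 := congrArg (fun p => (p ⟨_, hw'⟩ : MulAut D)) (MonoidHom.mem_ker.1 hg)
    have h2 : MulAut.conj (g * w * g⁻¹) = MulAut.conj w := by
      simpa [ψ, MulAut.conj_apply] using h1
    have h3 : MulAut.conj (g * w * g⁻¹ * w⁻¹) = 1 := by
      rw [map_mul, h2, map_inv, mul_inv_cancel]
    have h4 := congrArg (fun p : MulAut D => p c) h3
    simp only [MulAut.conj_apply, MulAut.one_apply] at h4
    exact mul_inv_eq_iff_eq_mul.1 h4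
  have : Group.IsSolvable ψ.ker := by
    refine isSolvable_of_commutator_mem_center ?_
    rintro ⟨g, hg⟩ ⟨h, hh⟩ ⟨c, hc⟩
    have key : ∀ w ∈ Ω, Commute (g * h * g⁻¹ * h⁻¹) w := by
      intro w hw
      have hz := hker g hg w hw
      have hz' := hker h hh w hw
      set z := g * w * g⁻¹ * w⁻¹ with hzd
      set z' := h * w * h⁻¹ * w⁻¹ with hzd'
      have e1 : g * w = z * w * g := by rw [hzd]; group
      have e2 : h * w = z' * w * h := by rw [hzd']; group
      have e3 : g * h * w = (z' * z) * w * (g * h) := by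
        rw [mul_assoc, e2, mul_assoc z', ← mul_assoc g, ← (hz' g).eq, mul_assoc, ← mul_assoc g, e1]
        simp only [mul_assoc]
      have e4 : h * g * w = (z' * z) * w * (h * g) := by
        rw [mul_assoc, e1, mul_assoc z, ← mul_assoc h, ← (hz h).eq, mul_assoc, ← mul_assoc h, e2,
          (hz' z).eq]
        simp only [mul_assoc]
      have e5 : ∀ c, Commute (z' * z) c := fun c => (hz' c).mul_left (hz c)
      exact commute_mul_inv_of_twisted e5 e3 e4
    have := hcentral _ (key a ha) (key b hb) c
    exact Subtype.ext this
  refine Group.isSolvable_of_ker_le_range ψ.ker.subtype ψ ?_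
  rw [Subgroup.range_subtype]

end RationalTraces

/-- A solvable normal subgroup is contained in any subgroup centralizing it that contains all
nilpotent normal subgroups below it. -/
theorem Subgroup.le_of_isSolvable_of_isNilpotent_le {G : Type*} [Group G] {C Z : Subgroup G}
    [C.Normal] [Group.IsSolvable C] (hZ : ∀ z ∈ Z, ∀ c ∈ C, c * z = z * c)
    (h : ∀ M : Subgroup G, M.Normal → M ≤ C → Group.IsNilpotent M → M ≤ Z) : C ≤ Z := by
  set L : ℕ → Subgroup G := fun n => (derivedSeries C n).map C.subtype with hL
  have hLC : ∀ n, L n ≤ C := fun n => map_subtype_le _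
  have hstep : ∀ n, L (n + 1) ≤ Z → L n ≤ Z := by
    intro n hn
    have hcomm : L (n + 1) = ⁅L n, L n⁆ := by
      simp only [hL, derivedSeries_succ, map_commutator]
    refine h _ (by simp only [hL]; infer_instance) (hLC n) ?_
    refine Subgroup.isNilpotent_of_ker_le_center (Abelianization.of (G := L n)) ?_
    rw [Abelianization.ker_of]
    intro x hx
    have hxZ : (x : G) ∈ Z := by
      apply hn
      rw [hcomm, ← map_subtype_commutator]
      exact ⟨x, hx, rfl⟩
    rw [mem_center_iff]
    exact fun g => Subtype.ext (hZ _ hxZ _ (hLC n g.2))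
  obtain ⟨n, hn⟩ := (Group.isSolvable_def C).1 inferInstance
  have h0 : ∀ k, L k ≤ Z → L 0 ≤ Z := by
    intro k
    induction k with
    | zero => exact id
    | succ k ih => exact fun hk => ih (hstep k hk)
  have := h0 n (by simp [hL, hn])
  simpa [hL, ← MonoidHom.range_eq_map] using this

section ReducedTrace

variable {A : Type*} [Ring A]

/-- The norm attached to a quadratic reduced trace is multiplicative. -/
theorem mul_sub_mul_self_multiplicative {t : A →+ A} (hc : ∀ a b, t a * b = b * t a)
    (hcomm : ∀ a b, t (a * b) = t (b * a)) (hlin : ∀ a b, t (t a * b) = t a * t b)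
    (hn : ∀ a b, (t a * a - a * a) * b = b * (t a * a - a * a))
    (htn : ∀ a, t (t a * a - a * a) = 2 * (t a * a - a * a))
    (h2 : ∀ a : A, 2 * a = 0 → a = 0) (b c : A) :
    t (b * c) * (b * c) - b * c * (b * c) = (t b * b - b * b) * (t c * c - c * c) := by
  have hW : b * c + c * b - t b * c - t c * b = t (b * c) - t b * t c := by
    have h1 := htn (b + c)
    have h2' := htn b
    have h3 := htn c
    simp only [map_sub, map_add, add_mul, mul_add, hlin, hcomm c b] at h1 h2' h3
    rw [hc c (t b)] at h1
    rw [← sub_eq_zero]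
    apply h2
    have h4 := congrArg₂ (· - ·) (congrArg₂ (· - ·) h1 h2') h3
    rw [← sub_eq_zero] at h4
    rw [← h4]
    noncomm_ring
  have hconj : t (b * c) - b * c = (t c - c) * (t b - b) := by
    rw [eq_add_of_sub_eq hW.symm]
    simp only [sub_mul, mul_sub, hc b c, hc c (t b)]
    abel
  calc t (b * c) * (b * c) - b * c * (b * c) = (t (b * c) - b * c) * (b * c) := by
        rw [sub_mul]
    _ = (t c - c) * ((t b * b - b * b) * c) := by
        rw [hconj]; simp only [sub_mul, mul_sub, mul_assoc]
    _ = (t b * b - b * b) * (t c * c - c * c) := by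
        rw [← mul_assoc, ← hn, mul_assoc, sub_mul (t c)]

end ReducedTrace

theorem isSolvable_of_reducedTrace {C A : Type*} [Group C] [Finite C] [Ring A] [Algebra ℚ A]
    [Nontrivial A] {f : C →* A} (hf : Function.Injective f) {t : A →+ A}
    (hc : ∀ a b, t a * b = b * t a)
    (hcomm : ∀ a b, t (a * b) = t (b * a)) (hlin : ∀ a b, t (t a * b) = t a * t b)
    (ht1 : t 1 = 2)
    (hn : ∀ a b, (t a * a - a * a) * b = b * (t a * a - a * a))
    (htn : ∀ a, t (t a * a - a * a) = 2 * (t a * a - a * a))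
    (hrat : ∀ g, f g + f g⁻¹ = t (f g) → ∃ q : ℚ, f g + f g⁻¹ = q • (1 : A)) :
    Group.IsSolvable C := by
  have h2 : ∀ a : A, 2 * a = 0 → a = 0 := by
    intro a ha
    have : (2 : ℚ) • a = 0 := by rw [two_smul, ← two_mul, ha]
    exact (smul_eq_zero.1 this).resolve_left (by norm_num)
  let ν : C →* Subring.center A :=
    { toFun := fun g => ⟨t (f g) * f g - f g * f g,
        Subring.mem_center_iff.2 fun b => (hn (f g) b).symm⟩
      map_one' := Subtype.ext (by simp [ht1, sub_eq_iff_eq_add, one_add_one_eq_two])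
      map_mul' := fun g h => Subtype.ext (by
        simp only [map_mul]
        exact mul_sub_mul_self_multiplicative hc hcomm hlin hn htn h2 _ _) }
  have hD : ∀ g ∈ commutator C, f g + f g⁻¹ = t (f g) := by
    intro g hg
    have h1 := Abelianization.commutator_subset_ker ν.toHomUnits hg
    have h3 := congrArg (fun u : (Subring.center A)ˣ => ((u : Subring.center A) : A))
      (MonoidHom.mem_ker.1 h1)
    have h4 : t (f g) * f g - f g * f g = 1 := by simpa [ν] using h3
    have h5 := congrArg (· * f g⁻¹) h4
    have h6 := f.map_mul_map_inv_eq_one g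
    simp only [sub_mul, mul_assoc, h6, mul_one, one_mul] at h5
    rw [← h5]; abel
  have hDs : Group.IsSolvable (commutator C) := by
    choose q hq using fun g : commutator C => hrat g (hD g g.2)
    exact isSolvable_of_add_inv_rational (f := f.comp (commutator C).subtype) (t := q)
      (hf.comp Subtype.val_injective) hq
  refine Group.isSolvable_of_ker_le_range (commutator C).subtype (Abelianization.of (G := C)) ?_
  rw [Abelianization.ker_of, Subgroup.range_subtype]

section OrthogonalFrame

variable {m n : Type*} [Fintype m] [DecidableEq m] [Fintype n] [DecidableEq n] {F : Matrix n n ℚ}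

theorem Matrix.toBilin'_vecMul {b c : Matrix n n ℚ} (h : b * F = F * cᵀ) (x y : n → ℚ) :
    Matrix.toBilin' F (x ᵥ* b) y = Matrix.toBilin' F x (y ᵥ* c) := by
  rw [Matrix.toBilin'_apply', Matrix.toBilin'_apply', Matrix.dotProduct_mulVec, vecMul_vecMul, h,
    ← vecMul_vecMul, ← Matrix.dotProduct_mulVec, mulVec_transpose, ← Matrix.dotProduct_mulVec]

/-- The dual frame of an orthogonal frame. -/
def dualFrame (F : Matrix n n ℚ) (p : m → n → ℚ) : Matrix n m ℚ :=
  F * (Matrix.of p)ᵀ * Matrix.diagonal fun k => (Matrix.toBilin' F (p k) (p k))⁻¹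

theorem vecMul_dualFrame (p : m → n → ℚ) (x : n → ℚ) (k : m) :
    (x ᵥ* dualFrame F p) k = Matrix.toBilin' F x (p k) * (Matrix.toBilin' F (p k) (p k))⁻¹ := by
  rw [dualFrame, ← vecMul_vecMul, vecMul_diagonal, ← vecMul_vecMul,
    Matrix.toBilin'_apply' F x, Matrix.dotProduct_mulVec]
  rfl

theorem dualFrame_mul {p : m → n → ℚ} (hcard : Fintype.card m = Fintype.card n)
    (hp : ∀ k l, k ≠ l → Matrix.toBilin' F (p k) (p l) = 0)
    (hd : ∀ k, Matrix.toBilin' F (p k) (p k) ≠ 0) : dualFrame F p * Matrix.of p = 1 := by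
  rw [Matrix.mul_eq_one_comm_of_equiv (Fintype.equivOfCardEq hcard.symm)]
  ext k l
  have h1 : (Matrix.of p * dualFrame F p) k l = (p k ᵥ* dualFrame F p) l := rfl
  rw [h1, vecMul_dualFrame]
  by_cases h : k = l
  · subst h; rw [mul_inv_cancel₀ (hd k), Matrix.one_apply_eq]
  · rw [hp k l h, zero_mul, Matrix.one_apply_ne h]

theorem eq_sum_of_orthogonal_frame {p : m → n → ℚ} (hcard : Fintype.card m = Fintype.card n)
    (hp : ∀ k l, k ≠ l → Matrix.toBilin' F (p k) (p l) = 0)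
    (hd : ∀ k, Matrix.toBilin' F (p k) (p k) ≠ 0) (x : n → ℚ) :
    x = ∑ k, (Matrix.toBilin' F x (p k) * (Matrix.toBilin' F (p k) (p k))⁻¹) • p k := by
  conv_lhs => rw [← vecMul_one x, ← dualFrame_mul hcard hp hd, ← vecMul_vecMul,
    vecMul_eq_sum]
  exact Finset.sum_congr rfl fun k _ => by rw [vecMul_dualFrame]; rfl

theorem trace_eq_sum_of_orthogonal_frame {p : m → n → ℚ}
    (hcard : Fintype.card m = Fintype.card n)
    (hp : ∀ k l, k ≠ l → Matrix.toBilin' F (p k) (p l) = 0)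
    (hd : ∀ k, Matrix.toBilin' F (p k) (p k) ≠ 0) (b : Matrix n n ℚ) :
    b.trace = ∑ k, Matrix.toBilin' F (p k ᵥ* b) (p k) * (Matrix.toBilin' F (p k) (p k))⁻¹ := by
  conv_lhs => rw [← mul_one b, ← dualFrame_mul hcard hp hd, ← Matrix.mul_assoc,
    Matrix.trace_mul_comm,
    ← Matrix.mul_assoc, Matrix.trace]
  refine Finset.sum_congr rfl fun k _ => ?_
  rw [← vecMul_dualFrame]
  rfl

end OrthogonalFrame

/-- A pair of anticommuting square roots of `-1` that are skew-adjoint for the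
positive definite form `F`. -/
structure IsQuaternionPair {n : Type*} [Fintype n] [DecidableEq n] (F i j : Matrix n n ℚ) :
    Prop where
  symm : Fᵀ = F
  pos : ∀ x, x ≠ 0 → 0 < Matrix.toBilin' F x x
  i_sq : i * i = -1
  j_sq : j * j = -1
  j_mul_i : j * i = -(i * j)
  i_adj : i * F = -(F * iᵀ)
  j_adj : j * F = -(F * jᵀ)

namespace IsQuaternionPair

variable {n : Type*} [Fintype n] [DecidableEq n] {F i j : Matrix n n ℚ}

/-- The basis `1, i, j, ij`. -/
def unit (i j : Matrix n n ℚ) : Fin 4 → Matrix n n ℚ := ![1, i, j, i * j]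

/-- The conjugate basis `1, -i, -j, -ij`. -/
def unitStar (i j : Matrix n n ℚ) : Fin 4 → Matrix n n ℚ := ![1, -i, -j, -(i * j)]

theorem unitStar_of_ne {l : Fin 4} (hl : l ≠ 0) : unitStar i j l = -unit i j l := by
  fin_cases l <;> simp_all [unit, unitStar]

theorem commute_unit {b : Matrix n n ℚ} (hi : Commute b i) (hj : Commute b j) (l : Fin 4) :
    Commute b (unit i j l) := by
  fin_cases l
  · simp [unit]
  · simpa [unit] using hi
  · simpa [unit] using hj
  · simpa [unit] using hi.mul_right hj

theorem exists_orthogonal (hn : 4 < Fintype.card n) (v : n → ℚ) :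
    ∃ w, w ≠ 0 ∧ ∀ l, Matrix.toBilin' F w (v ᵥ* unit i j l) = 0 := by
  let φ : (n → ℚ) →ₗ[ℚ] Fin 4 → ℚ :=
    LinearMap.pi fun l => (Matrix.toBilin' F).flip (v ᵥ* unit i j l)
  have : LinearMap.ker φ ≠ ⊥ := LinearMap.ker_ne_bot_of_finrank_lt (by simpa using hn)
  obtain ⟨w, hw, hw0⟩ := Submodule.exists_mem_ne_zero_of_ne_bot this
  exact ⟨w, hw0, fun l => congrFun (LinearMap.mem_ker.1 hw) l⟩

variable (h : IsQuaternionPair F i j)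
include h

theorem form_comm (x y : n → ℚ) : Matrix.toBilin' F x y = Matrix.toBilin' F y x := by
  rw [Matrix.toBilin'_apply', Matrix.toBilin'_apply', Matrix.dotProduct_mulVec, dotProduct_comm,
    ← mulVec_transpose, h.symm]

theorem form_vecMul_unit (l : Fin 4) (x y : n → ℚ) :
    Matrix.toBilin' F (x ᵥ* unit i j l) y = Matrix.toBilin' F x (y ᵥ* unitStar i j l) := by
  apply Matrix.toBilin'_vecMul
  have h1 := h.i_adj
  have h2 := h.j_adj
  fin_cases l
  · simp [unit, unitStar]
  · simp [unit, unitStar, h1]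
  · simp [unit, unitStar, h2]
  · have h3 : i * j * F = F * (j * i)ᵀ := by
      rw [mul_assoc, h2, mul_neg, ← mul_assoc, h1, Matrix.transpose_mul]; simp [mul_assoc]
    simp [unit, unitStar, h3, h.j_mul_i]

set_option linter.unusedSimpArgs false in
theorem unit_mul_unitStar_of_ne {l m : Fin 4} (hlm : l ≠ m) :
    ∃ r, r ≠ 0 ∧ ∃ s : ℚ, unit i j l * unitStar i j m = s • unit i j r := by
  have h1 := h.i_sq
  have h2 := h.j_sq
  have h3 := h.j_mul_i
  have h1' : ∀ x, i * (i * x) = -x := fun x => by rw [← mul_assoc, h1]; simp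
  have h3' : ∀ x, j * (i * x) = -(i * (j * x)) := fun x => by
    rw [← mul_assoc, h3]; simp [mul_assoc]
  fin_cases l <;> fin_cases m <;> first
  | exact absurd rfl hlm
  | (refine ⟨1, by decide, 1, ?_⟩; simp [unit, unitStar, mul_assoc, h1, h2, h3, h1', h3']; done)
  | (refine ⟨1, by decide, -1, ?_⟩; simp [unit, unitStar, mul_assoc, h1, h2, h3, h1', h3']; done)
  | (refine ⟨2, by decide, 1, ?_⟩; simp [unit, unitStar, mul_assoc, h1, h2, h3, h1', h3']; done)
  | (refine ⟨2, by decide, -1, ?_⟩; simp [unit, unitStar, mul_assoc, h1, h2, h3, h1', h3']; done)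
  | (refine ⟨3, by decide, 1, ?_⟩; simp [unit, unitStar, mul_assoc, h1, h2, h3, h1', h3']; done)
  | (refine ⟨3, by decide, -1, ?_⟩; simp [unit, unitStar, mul_assoc, h1, h2, h3, h1', h3'])

theorem unit_mul_unitStar_self (l : Fin 4) : unit i j l * unitStar i j l = 1 := by
  have h1 := h.i_sq
  have h2 := h.j_sq
  have h3' : j * (i * j) = i := by rw [← mul_assoc, h.j_mul_i, neg_mul, mul_assoc, h2]; simp
  fin_cases l <;> simp [unit, unitStar, mul_assoc, h1, h2, h3']

theorem form_unit_vecMul (l : Fin 4) (x y : n → ℚ) :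
    Matrix.toBilin' F x (y ᵥ* unit i j l) = Matrix.toBilin' F (x ᵥ* unitStar i j l) y := by
  by_cases hl : l = 0
  · subst hl; simp [unit, unitStar]
  · have := h.form_vecMul_unit l x y
    rw [unitStar_of_ne hl] at this ⊢
    rw [vecMul_neg, map_neg] at this
    rw [vecMul_neg, map_neg, LinearMap.neg_apply, this, neg_neg]

theorem form_unit_unit_self (l : Fin 4) (x y : n → ℚ) :
    Matrix.toBilin' F (x ᵥ* unit i j l) (y ᵥ* unit i j l) = Matrix.toBilin' F x y := by
  rw [h.form_unit_vecMul, vecMul_vecMul, h.unit_mul_unitStar_self, vecMul_one]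

theorem form_unit_unit_of_ne {l m : Fin 4} (hlm : l ≠ m) {x y : n → ℚ}
    (hxy : ∀ r, r ≠ 0 → Matrix.toBilin' F (x ᵥ* unit i j r) y = 0) :
    Matrix.toBilin' F (x ᵥ* unit i j l) (y ᵥ* unit i j m) = 0 := by
  obtain ⟨r, hr, s, hs⟩ := h.unit_mul_unitStar_of_ne hlm
  rw [h.form_unit_vecMul, vecMul_vecMul, hs, vecMul_smul, map_smul, LinearMap.smul_apply, hxy r hr,
    smul_zero]

theorem form_vecMul_unit_self {b : Matrix n n ℚ} (hb : b * F = F * bᵀ)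
    (hbc : ∀ l, Commute b (unit i j l)) {r : Fin 4} (hr : r ≠ 0) (x : n → ℚ) :
    Matrix.toBilin' F (x ᵥ* b) (x ᵥ* unit i j r) = 0 := by
  have h1 : Matrix.toBilin' F (x ᵥ* b ᵥ* unit i j r) x =
      Matrix.toBilin' F (x ᵥ* b) (x ᵥ* unit i j r) := by
    rw [vecMul_vecMul, (hbc r).eq, ← vecMul_vecMul, Matrix.toBilin'_vecMul hb, h.form_comm]
  have h2 : Matrix.toBilin' F (x ᵥ* b ᵥ* unit i j r) x =
      -Matrix.toBilin' F (x ᵥ* b) (x ᵥ* unit i j r) := by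
    rw [h.form_vecMul_unit, unitStar_of_ne hr, vecMul_neg, map_neg]
  linarith

theorem unit_comb_mul (c : Fin 4 → ℚ) :
    (∑ l, c l • unit i j l) * ∑ l, c l • unitStar i j l = (∑ l, c l ^ 2) • 1 := by
  have h1 := h.i_sq
  have h2 := h.j_sq
  have h3 := h.j_mul_i
  have h1' : ∀ x, i * (i * x) = -x := fun x => by rw [← mul_assoc, h1]; simp
  have h3' : ∀ x, j * (i * x) = -(i * (j * x)) := fun x => by
    rw [← mul_assoc, h3]; simp [mul_assoc]
  simp only [Fin.sum_univ_four, unit, unitStar, Matrix.cons_val, add_mul, mul_add,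
    smul_mul_smul_comm, mul_neg, mul_one, one_mul, mul_assoc, h1, h2, h3, h1', h3', neg_neg]
  module

theorem unit_comb_mul' (c : Fin 4 → ℚ) :
    (∑ l, c l • unitStar i j l) * ∑ l, c l • unit i j l = (∑ l, c l ^ 2) • 1 := by
  have h1 := h.i_sq
  have h2 := h.j_sq
  have h3 := h.j_mul_i
  have h1' : ∀ x, i * (i * x) = -x := fun x => by rw [← mul_assoc, h1]; simp
  have h3' : ∀ x, j * (i * x) = -(i * (j * x)) := fun x => by
    rw [← mul_assoc, h3]; simp [mul_assoc]
  simp only [Fin.sum_univ_four, unit, unitStar, Matrix.cons_val, add_mul, mul_add,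
    smul_mul_smul_comm, mul_neg, neg_mul, mul_one, one_mul, mul_assoc, h1, h2, h3, h1', h3', neg_neg]
  module

theorem exists_hermitian_sq (hn : Fintype.card n = 8) {b : Matrix n n ℚ} (hb : b * F = F * bᵀ)
    (hi : Commute b i) (hj : Commute b j) :
    ∃ ν : ℚ, b * b = (b.trace / 4) • b - ν • 1 := by
  set B := Matrix.toBilin' F with hB
  have hbc := commute_unit hi hj
  have : Nonempty n := Fintype.card_pos_iff.1 (by omega)
  obtain ⟨v, hv⟩ := exists_ne (0 : n → ℚ)
  obtain ⟨w, hw, hwv⟩ := exists_orthogonal (F := F) (i := i) (j := j) (by omega) v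
  have hself : ∀ x, ∀ r : Fin 4, r ≠ 0 → B (x ᵥ* unit i j r) x = 0 := by
    intro x r hr
    have := h.form_vecMul_unit_self (b := 1) (by simp) (fun l => Commute.one_left _) hr x
    rwa [vecMul_one, h.form_comm] at this
  have hwv' : ∀ r, B (w ᵥ* unit i j r) v = 0 := by
    intro r
    by_cases hr : r = 0
    · subst hr; simpa [unit] using hwv 0
    · rw [h.form_vecMul_unit, unitStar_of_ne hr, vecMul_neg, map_neg, hwv, neg_zero]
  set u : Fin 2 → n → ℚ := ![v, w] with hu
  have hu0 : ∀ a, u a ≠ 0 := by intro a; fin_cases a <;> simpa [u]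
  set p : Fin 2 × Fin 4 → n → ℚ := fun k => u k.1 ᵥ* unit i j k.2 with hp
  have hpd : ∀ k, B (p k) (p k) = B (u k.1) (u k.1) := fun k => h.form_unit_unit_self _ _ _
  have hcard : Fintype.card (Fin 2 × Fin 4) = Fintype.card n := by simp [hn]
  have hwvp : ∀ l m, B (w ᵥ* unit i j l) (v ᵥ* unit i j m) = 0 := by
    intro l m
    by_cases hlm : l = m
    · subst hlm; rw [h.form_unit_unit_self]; simpa [unit] using hwv 0
    · exact h.form_unit_unit_of_ne hlm fun r _ => hwv' r
  have hp0 : ∀ k l, k ≠ l → B (p k) (p l) = 0 := by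
    rintro ⟨a, l⟩ ⟨a', m⟩ hne
    by_cases haa : a = a'
    · subst haa
      have hlm : l ≠ m := fun e => hne (by rw [e])
      exact h.form_unit_unit_of_ne hlm (hself _)
    · fin_cases a <;> fin_cases a'
      · exact absurd rfl haa
      · exact (h.form_comm _ _).trans (hwvp m l)
      · exact hwvp l m
      · exact absurd rfl haa
  have hp1 : ∀ k, B (p k) (p k) ≠ 0 := fun k => by rw [hpd]; exact (h.pos _ (hu0 _)).ne'
  set lam := B v v with hlam
  set kap := B w w with hkap
  have hlam0 : lam ≠ 0 := (h.pos v hv).ne'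
  have hkap0 : kap ≠ 0 := (h.pos w hw).ne'
  set α := B (v ᵥ* b) v * lam⁻¹ with hα
  set δ := B (w ᵥ* b) w * kap⁻¹ with hδ
  set c : Fin 4 → ℚ := fun l => B (v ᵥ* b) (w ᵥ* unit i j l) with hc
  set Q := ∑ l, c l • unit i j l with hQ
  set Q' := ∑ l, c l • unitStar i j l with hQ'
  have hexp : ∀ x, x = ∑ l, (B x (v ᵥ* unit i j l) * lam⁻¹) • (v ᵥ* unit i j l) +
      ∑ l, (B x (w ᵥ* unit i j l) * kap⁻¹) • (w ᵥ* unit i j l) := by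
    intro x
    conv_lhs => rw [eq_sum_of_orthogonal_frame hcard hp0 hp1 x]
    rw [Fintype.sum_prod_type, Fin.sum_univ_two]
    simp only [← hB, hpd]
    rfl
  have hvb : v ᵥ* b = α • v + kap⁻¹ • (w ᵥ* Q) := by
    conv_lhs => rw [hexp (v ᵥ* b)]
    rw [Finset.sum_eq_single 0 (fun l _ hl => by
      rw [h.form_vecMul_unit_self hb hbc hl, zero_mul, zero_smul]) (by simp), hQ, Matrix.vecMul_sum,
      Finset.smul_sum]
    congr 1
    · simp [unit, hα]
    · exact Finset.sum_congr rfl fun l _ => by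
        rw [vecMul_smul, smul_smul, mul_comm]
  have hwb : w ᵥ* b = δ • w + lam⁻¹ • (v ᵥ* Q') := by
    have hc' : ∀ l, B (w ᵥ* b) (v ᵥ* unit i j l) • (v ᵥ* unit i j l) =
        c l • (v ᵥ* unitStar i j l) := by
      intro l
      have h1 : B (w ᵥ* b) (v ᵥ* unit i j l) = B (v ᵥ* b) (w ᵥ* unitStar i j l) := by
        rw [Matrix.toBilin'_vecMul hb, vecMul_vecMul, ← (hbc l).eq, ← vecMul_vecMul,
          h.form_unit_vecMul, h.form_comm]
      by_cases hl : l = 0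
      · subst hl; rw [h1]; simp [unit, unitStar, hc]
      · rw [h1, unitStar_of_ne hl, vecMul_neg, vecMul_neg, map_neg, neg_smul, smul_neg]
    conv_lhs => rw [hexp (w ᵥ* b)]
    rw [Finset.sum_eq_single (s := Finset.univ)
      (f := fun l => (B (w ᵥ* b) (w ᵥ* unit i j l) * kap⁻¹) • (w ᵥ* unit i j l)) 0
      (fun l _ hl => by
      rw [h.form_vecMul_unit_self hb hbc hl, zero_mul, zero_smul]) (by simp), hQ',
      Matrix.vecMul_sum,
      Finset.smul_sum, add_comm]
    congr 1
    · simp [unit, hδ]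
    · exact Finset.sum_congr rfl fun l _ => by
        rw [vecMul_smul, ← hc', smul_smul, mul_comm]
  have htr : b.trace = 4 * (α + δ) := by
    have h1 : ∀ a l, B (p (a, l) ᵥ* b) (p (a, l)) = B (u a ᵥ* b) (u a) := by
      intro a l
      simp only [hp]
      rw [vecMul_vecMul, ← (hbc l).eq, ← vecMul_vecMul, h.form_unit_unit_self]
    rw [trace_eq_sum_of_orthogonal_frame hcard hp0 hp1, Fintype.sum_prod_type, Fin.sum_univ_two]
    simp only [← hB, hpd, h1, Finset.sum_const, Finset.card_univ, Fintype.card_fin]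
    simp [u, hα, hδ, hlam, hkap]
    ring
  set N := ∑ l, c l ^ 2
  have hQQ : Q * Q' = N • 1 := h.unit_comb_mul c
  have hQQ' : Q' * Q = N • 1 := h.unit_comb_mul' c
  have hbQ : Commute b Q := Commute.sum_right _ _ _ fun l _ => (hbc l).smul_right _
  have hbQ' : Commute b Q' := Commute.sum_right _ _ _ fun l _ => by
    by_cases hl : l = 0
    · subst hl; exact (Commute.one_right b).smul_right _
    · rw [unitStar_of_ne hl]; exact ((hbc l).neg_right).smul_right _
  refine ⟨α * δ - lam⁻¹ * kap⁻¹ * N, ?_⟩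
  rw [← sub_eq_zero, htr, mul_div_cancel_left₀ _ (by norm_num)]
  set Z := b * b - ((α + δ) • b - (α * δ - lam⁻¹ * kap⁻¹ * N) • 1) with hZ
  have hZv : v ᵥ* Z = 0 := by
    have h1 : v ᵥ* (b * b) = α • (v ᵥ* b) + kap⁻¹ • (δ • (w ᵥ* Q) + (lam⁻¹ * N) • v) := by
      rw [← vecMul_vecMul]
      conv_lhs => rw [hvb]
      rw [Matrix.add_vecMul, Matrix.smul_vecMul, Matrix.smul_vecMul, vecMul_vecMul, ← hbQ.eq,
        ← vecMul_vecMul, hwb, Matrix.add_vecMul, Matrix.smul_vecMul, Matrix.smul_vecMul,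
        vecMul_vecMul v, hQQ', vecMul_smul, vecMul_one, smul_smul lam⁻¹]
    have h2 : w ᵥ* Q = kap • (v ᵥ* b - α • v) := by
      rw [hvb, add_sub_cancel_left, smul_smul, mul_inv_cancel₀ hkap0, one_smul]
    rw [hZ, vecMul_sub, vecMul_sub, h1, h2, vecMul_smul, vecMul_smul, vecMul_one]
    match_scalars <;> field_simp <;> ring
  have hZw : w ᵥ* Z = 0 := by
    have h1 : w ᵥ* (b * b) = δ • (w ᵥ* b) + lam⁻¹ • (α • (v ᵥ* Q') + (kap⁻¹ * N) • w) := by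
      rw [← vecMul_vecMul]
      conv_lhs => rw [hwb]
      rw [Matrix.add_vecMul, Matrix.smul_vecMul, Matrix.smul_vecMul, vecMul_vecMul, ← hbQ'.eq,
        ← vecMul_vecMul, hvb, Matrix.add_vecMul, Matrix.smul_vecMul, Matrix.smul_vecMul,
        vecMul_vecMul w, hQQ, vecMul_smul, vecMul_one, smul_smul kap⁻¹]
    have h2 : v ᵥ* Q' = lam • (w ᵥ* b - δ • w) := by
      rw [hwb, add_sub_cancel_left, smul_smul, mul_inv_cancel₀ hlam0, one_smul]
    rw [hZ, vecMul_sub, vecMul_sub, h1, h2, vecMul_smul, vecMul_smul, vecMul_one]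
    match_scalars <;> field_simp <;> ring
  have hZc : ∀ l, unit i j l * Z = Z * unit i j l := by
    intro l
    have := (hbc l).eq
    simp only [hZ, mul_sub, sub_mul, mul_smul_comm, smul_mul_assoc, mul_one, one_mul,
      mul_assoc, this]
    simp only [← mul_assoc, this]
  ext r s
  have h3 : (Pi.single r 1 : n → ℚ) ᵥ* Z = 0 := by
    rw [hexp (Pi.single r 1), Matrix.add_vecMul, Matrix.sum_vecMul, Matrix.sum_vecMul]
    simp only [Matrix.smul_vecMul, vecMul_vecMul, hZc]
    simp only [← vecMul_vecMul, hZv, hZw, zero_vecMul, smul_zero, Finset.sum_const_zero, add_zero]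
  have h4 := congrFun h3 s
  rwa [Matrix.single_one_vecMul] at h4

end IsQuaternionPair

section InvariantForm

variable {n : Type*} [Fintype n] [DecidableEq n]

/-- A finite matrix group preserves a positive definite form. -/
theorem exists_invariant_form {G : Subgroup (GL n ℚ)} (hG : (G : Set (GL n ℚ)).Finite) :
    ∃ F : Matrix n n ℚ, Fᵀ = F ∧ (∀ x, x ≠ 0 → 0 < Matrix.toBilin' F x x) ∧
      ∀ g ∈ G, (g : Matrix n n ℚ) * F * (g : Matrix n n ℚ)ᵀ = F := by
  have := hG.fintype
  refine ⟨∑ g : G, g.1.1 * g.1.1ᵀ, ?_, ?_, ?_⟩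
  · simp [Matrix.transpose_sum, Matrix.transpose_mul]
  · intro x hx
    have hterm : ∀ g : G, Matrix.toBilin' (g.1.1 * g.1.1ᵀ) x x =
        (x ᵥ* g.1.1) ⬝ᵥ (x ᵥ* g.1.1) := by
      intro g
      rw [Matrix.toBilin'_apply', Matrix.dotProduct_mulVec, ← vecMul_vecMul,
        ← Matrix.dotProduct_mulVec, mulVec_transpose]
    rw [map_sum, LinearMap.sum_apply, LinearMap.sum_apply]
    refine Finset.sum_pos' (fun g _ => ?_) ⟨1, Finset.mem_univ _, ?_⟩
    · rw [hterm]; exact Finset.sum_nonneg fun i _ => mul_self_nonneg _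
    · rw [hterm]
      have h1 := (Finset.sum_nonneg fun i _ => mul_self_nonneg (x i) : 0 ≤ x ⬝ᵥ x)
      have h2 : x ᵥ* (1 : G).1.1 = x := vecMul_one x
      rw [h2]
      exact lt_of_le_of_ne h1 (Ne.symm (dotProduct_self_eq_zero.not.2 hx))
  · intro g hg
    rw [Finset.mul_sum, Finset.sum_mul]
    refine Fintype.sum_equiv (Equiv.mulLeft (⟨g, hg⟩ : G)) _ _ fun h => ?_
    simp [Matrix.transpose_mul, Matrix.mul_assoc]

theorem isUnit_of_form_pos {F : Matrix n n ℚ} (hF : ∀ x, x ≠ 0 → 0 < Matrix.toBilin' F x x) :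
    IsUnit F := by
  rw [← Matrix.vecMul_injective_iff_isUnit, ← Matrix.coe_vecMulLinear, ← LinearMap.ker_eq_bot,
    LinearMap.ker_eq_bot']
  intro x hx
  by_contra h0
  have := hF x h0
  rw [Matrix.toBilin'_apply', Matrix.dotProduct_mulVec] at this
  simp only [Matrix.vecMulLinear_apply] at hx
  rw [hx, zero_dotProduct] at this
  exact lt_irrefl _ this

end InvariantForm

section Maximal

variable {n : ℕ} {G : Subgroup (GL (Fin n ⊕ Fin n) ℚ)}

/-- A maximal finite symplectic group contains every finite group it normalizes that preserves a
common symplectic form. -/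
theorem le_of_maximal_symplectic (hfin : (G : Set (GL (Fin n ⊕ Fin n) ℚ)).Finite)
    (hmax : ∀ H : Subgroup (GL (Fin n ⊕ Fin n) ℚ), (H : Set (GL (Fin n ⊕ Fin n) ℚ)).Finite →
      IsSymplecticGroup H → G ≤ H → H = G)
    {S : Subgroup (GL (Fin n ⊕ Fin n) ℚ)} (hS : (S : Set (GL (Fin n ⊕ Fin n) ℚ)).Finite)
    (hnorm : ∀ g ∈ G, ∀ s ∈ S, g * s * g⁻¹ ∈ S)
    {A : Matrix (Fin n ⊕ Fin n) (Fin n ⊕ Fin n) ℚ} (hA : Aᵀ = -A) (hAu : IsUnit A)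
    (hGA : ∀ g ∈ G, (g : Matrix (Fin n ⊕ Fin n) (Fin n ⊕ Fin n) ℚ) * A *
      (g : Matrix (Fin n ⊕ Fin n) (Fin n ⊕ Fin n) ℚ)ᵀ = A)
    (hSA : ∀ g ∈ S, (g : Matrix (Fin n ⊕ Fin n) (Fin n ⊕ Fin n) ℚ) * A *
      (g : Matrix (Fin n ⊕ Fin n) (Fin n ⊕ Fin n) ℚ)ᵀ = A) : S ≤ G := by
  have hc := Subgroup.coe_mul_of_left_le_normalizer_right G S (Subgroup.le_normalizer_iff.2 hnorm)
  have := hmax (G ⊔ S) (by rw [hc]; exact hfin.mul hS) ⟨A, hA, hAu, ?_⟩ le_sup_left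
  · rw [← this]; exact le_sup_right
  · intro x hx
    rw [← SetLike.mem_coe, hc] at hx
    obtain ⟨g, hg, s, hs, rfl⟩ := hx
    rw [Units.val_mul, Matrix.transpose_mul]
    calc _ = (g : Matrix (Fin n ⊕ Fin n) (Fin n ⊕ Fin n) ℚ) * (s.1 * A * s.1ᵀ) *
        (g : Matrix (Fin n ⊕ Fin n) (Fin n ⊕ Fin n) ℚ)ᵀ := by simp only [Matrix.mul_assoc]
      _ = A := by rw [hSA s hs, hGA g hg]

theorem sup_finite_of_normalizes {S : Subgroup (GL (Fin n ⊕ Fin n) ℚ)}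
    (hfin : (G : Set (GL (Fin n ⊕ Fin n) ℚ)).Finite)
    (hS : (S : Set (GL (Fin n ⊕ Fin n) ℚ)).Finite)
    (hnorm : ∀ g ∈ G, ∀ s ∈ S, g * s * g⁻¹ ∈ S) :
    ((G ⊔ S : Subgroup _) : Set (GL (Fin n ⊕ Fin n) ℚ)).Finite := by
  rw [Subgroup.coe_mul_of_left_le_normalizer_right G S (Subgroup.le_normalizer_iff.2 hnorm)]
  exact hfin.mul hS

/-- Schur's lemma for the natural module. -/
theorem IsRatIrreducible.isUnit_of_commute (h : IsRatIrreducible G)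
    {X : Matrix (Fin n ⊕ Fin n) (Fin n ⊕ Fin n) ℚ} (hX : X ≠ 0)
    (hc : ∀ g ∈ G, Commute X (g : Matrix (Fin n ⊕ Fin n) (Fin n ⊕ Fin n) ℚ)) : IsUnit X := by
  rw [← Matrix.vecMul_injective_iff_isUnit, ← Matrix.coe_vecMulLinear, ← LinearMap.ker_eq_bot]
  refine (h (LinearMap.ker X.vecMulLinear) ?_).resolve_right ?_
  · intro g hg v hv
    simp only [LinearMap.mem_ker, Matrix.vecMulLinear_apply] at hv ⊢
    rw [vecMul_vecMul, ← (hc g hg).eq, ← vecMul_vecMul, hv, zero_vecMul]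
  · intro htop
    apply hX
    ext r s
    have : (Pi.single r 1 : Fin n ⊕ Fin n → ℚ) ∈ LinearMap.ker X.vecMulLinear := by simp [htop]
    simp only [LinearMap.mem_ker, Matrix.vecMulLinear_apply] at this
    have h4 := congrFun this s
    rwa [Matrix.single_one_vecMul] at h4

end Maximal

/-- A finite irreducible maximal symplectic group `G` in degree `8` with Fitting subgroup `N`, a
quaternion group generated by `i` and `j`. -/
structure HasQuaternionFitting (G N : Subgroup (GL (Fin 4 ⊕ Fin 4) ℚ))
    (i j : GL (Fin 4 ⊕ Fin 4) ℚ) : Prop where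
  finite : (G : Set (GL (Fin 4 ⊕ Fin 4) ℚ)).Finite
  symplectic : IsSymplecticGroup G
  irreducible : IsRatIrreducible G
  maximal : ∀ H : Subgroup (GL (Fin 4 ⊕ Fin 4) ℚ), (H : Set (GL (Fin 4 ⊕ Fin 4) ℚ)).Finite →
    IsSymplecticGroup H → G ≤ H → H = G
  le : N ≤ G
  normal : ∀ g ∈ G, ∀ x ∈ N, g * x * g⁻¹ ∈ N
  nilpotent_le : ∀ M : Subgroup (GL (Fin 4 ⊕ Fin 4) ℚ), M ≤ G →
    (∀ g ∈ G, ∀ x ∈ M, g * x * g⁻¹ ∈ M) → Group.IsNilpotent M → M ≤ N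
  i_mem : i ∈ N
  j_mem : j ∈ N
  i_sq : i * i = -1
  j_sq : j * j = -1
  j_mul_i : j * i = -(i * j)
  mem : ∀ x ∈ N, x = 1 ∨ x = -1 ∨ x = i ∨ x = -i ∨ x = j ∨ x = -j ∨ x = i * j ∨ x = -(i * j)

theorem isNilpotent_zpowers {G : Type*} [Group G] (g : G) :
    Group.IsNilpotent (Subgroup.zpowers g) :=
  letI := IsCyclic.commGroup (α := Subgroup.zpowers g)
  CommGroup.isNilpotent

theorem zpowers_neg_one_finite {n : Type*} [Fintype n] [DecidableEq n] :
    (Subgroup.zpowers (-1 : GL n ℚ) : Set (GL n ℚ)).Finite := by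
  have : IsOfFinOrder (-1 : GL n ℚ) := isOfFinOrder_iff_pow_eq_one.2 ⟨2, by norm_num, by simp⟩
  exact this.finite_zpowers

theorem IsSPIMF.exists_hasQuaternionFitting {G : Subgroup (GL (Fin 4 ⊕ Fin 4) ℚ)} {N : Subgroup G}
    (hG : IsSPIMF G) (hN : N.Normal)
    (hF : ∀ N' : Subgroup G, N'.Normal → Group.IsNilpotent N' → N' ≤ N)
    (e : N ≃* QuaternionGroup 2) : ∃ i j, HasQuaternionFitting G (N.map G.subtype) i j := by
  obtain ⟨hfin, hsymp, hirr, -, hmax⟩ := hG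
  have hnil : ∀ M : Subgroup (GL (Fin 4 ⊕ Fin 4) ℚ), M ≤ G →
      (∀ g ∈ G, ∀ x ∈ M, g * x * g⁻¹ ∈ M) → Group.IsNilpotent M → M ≤ N.map G.subtype := by
    intro M hMG hMn hM
    have h1 : M.subgroupOf G ≤ N := by
      refine hF _ ⟨fun x hx g => ?_⟩ ?_
      · exact hMn g g.2 x hx
      · exact Group.nilpotent_of_mulEquiv (Subgroup.subgroupOfEquivOfLe hMG).symm
    intro x hx
    exact ⟨⟨x, hMG hx⟩, h1 hx, rfl⟩
  have hneg : (-1 : GL (Fin 4 ⊕ Fin 4) ℚ) ∈ N.map G.subtype := by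
    obtain ⟨A, hA, hAu, hGA⟩ := hsymp
    have hz : ∀ x ∈ Subgroup.zpowers (-1 : GL (Fin 4 ⊕ Fin 4) ℚ), x = 1 ∨ x = -1 := by
      rintro x ⟨k, rfl⟩
      rcases Int.even_or_odd k with hk | hk
      · exact Or.inl hk.neg_one_zpow
      · exact Or.inr hk.neg_one_zpow
    have hn : ∀ g ∈ G, ∀ s ∈ Subgroup.zpowers (-1 : GL (Fin 4 ⊕ Fin 4) ℚ),
        g * s * g⁻¹ ∈ Subgroup.zpowers (-1 : GL (Fin 4 ⊕ Fin 4) ℚ) := by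
      intro g _ s hs
      rcases hz s hs with rfl | rfl
      · simp
      · simp
    have hle := le_of_maximal_symplectic hfin hmax zpowers_neg_one_finite hn hA hAu hGA (by
      intro s hs
      rcases hz s hs with rfl | rfl <;> simp)
    exact hnil _ hle hn (isNilpotent_zpowers _) (Subgroup.mem_zpowers _)
  obtain ⟨z, hz, hz1⟩ := hneg
  have hz1' : (z : GL (Fin 4 ⊕ Fin 4) ℚ) = -1 := hz1
  have hez : e ⟨z, hz⟩ = QuaternionGroup.a 2 := by
    have key : ∀ x : QuaternionGroup 2, x * x = 1 → x = 1 ∨ x = QuaternionGroup.a 2 := by decide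
    refine (key _ ?_).resolve_left ?_
    · rw [← map_mul, ← map_one e]
      congr 1
      ext1; ext1
      simp [hz1']
    · rw [EmbeddingLike.map_eq_one_iff]
      intro h
      have := congrArg (fun x : N => ((x : G) : GL (Fin 4 ⊕ Fin 4) ℚ)) h
      simp only [hz1', OneMemClass.coe_one] at this
      have h2 := congrArg (fun x : GL (Fin 4 ⊕ Fin 4) ℚ => x.1 (Sum.inl 0) (Sum.inl 0)) this
      norm_num at h2
  let f : QuaternionGroup 2 →* GL (Fin 4 ⊕ Fin 4) ℚ :=
    G.subtype.comp (N.subtype.comp e.symm.toMonoidHom)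
  have hf2 : f (QuaternionGroup.a 2) = -1 := by
    simp only [f, ← hez]
    simp [hz1']
  have hfm : ∀ q, f q ∈ N.map G.subtype := fun q => ⟨(e.symm q : N), (e.symm q).2, rfl⟩
  refine ⟨f (QuaternionGroup.a 1), f (QuaternionGroup.xa 0), hfin, hsymp, hirr, hmax,
    Subgroup.map_subtype_le _, ?_, hnil, hfm _, hfm _, ?_, ?_, ?_, ?_⟩
  · rintro g hg _ ⟨x, hx, rfl⟩
    exact ⟨_, hN.conj_mem x hx ⟨g, hg⟩, rfl⟩
  · rw [← map_mul, ← hf2]; rfl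
  · rw [← map_mul, ← hf2]; rfl
  · rw [← map_mul, ← neg_one_mul, ← hf2, ← map_mul, ← map_mul]; rfl
  · rintro _ ⟨x, hx, rfl⟩
    have hxf : G.subtype x = f (e ⟨x, hx⟩) := by simp [f]
    rw [hxf]
    have key : ∀ q : QuaternionGroup 2, q = 1 ∨ q = .a 2 ∨ q = .a 1 ∨ q = .a 2 * .a 1 ∨
      q = .xa 0 ∨ q = .a 2 * .xa 0 ∨ q = .a 1 * .xa 0 ∨ q = .a 2 * (.a 1 * .xa 0) := by decide
    rcases key (e ⟨x, hx⟩) with h | h | h | h | h | h | h | h <;> rw [h] <;>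
      simp only [map_mul, map_one, hf2, neg_mul, one_mul, true_or, or_true]

section QuaternionHom

open scoped Quaternion

variable {A : Type*} [Ring A] [Algebra ℚ A]

/-- The algebra homomorphism from the rational quaternions given by anticommuting square roots of
`-1`. -/
def quatHom {i j : A} (hi : i * i = -1) (hj : j * j = -1) (hij : j * i = -(i * j)) :
    ℍ[ℚ] →ₐ[ℚ] A :=
  QuaternionAlgebra.Basis.liftHom
    { i := i, j := j, k := i * j, i_mul_i := by simp [hi], j_mul_j := by simp [hj]
      i_mul_j := rfl, j_mul_i := by simp [hij] }

variable {i j : A} (hi : i * i = -1) (hj : j * j = -1) (hij : j * i = -(i * j))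

theorem quatHom_apply (a : ℍ[ℚ]) : quatHom hi hj hij a =
    a.re • (1 : A) + a.imI • i + a.imJ • j + a.imK • (i * j) := by
  change algebraMap ℚ A a.re + _ + _ + _ = _
  rw [Algebra.algebraMap_eq_smul_one]

theorem i_mem_range_quatHom : i ∈ (quatHom hi hj hij).range :=
  ⟨⟨0, 1, 0, 0⟩, (quatHom_apply hi hj hij _).trans (by simp)⟩

theorem j_mem_range_quatHom : j ∈ (quatHom hi hj hij).range :=
  ⟨⟨0, 0, 1, 0⟩, (quatHom_apply hi hj hij _).trans (by simp)⟩

theorem mem_range_units_map_quatHom [Nontrivial A] {s : Aˣ} :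
    s ∈ (Units.map (quatHom hi hj hij : ℍ[ℚ] →* A)).range ↔
      (s : A) ∈ (quatHom hi hj hij).range := by
  constructor
  · rintro ⟨a, rfl⟩
    exact ⟨a, rfl⟩
  · rintro ⟨a, ha⟩
    have ha' : quatHom hi hj hij a = s := ha
    have ha0 : a ≠ 0 := by
      rintro rfl
      rw [map_zero] at ha'
      exact s.ne_zero ha'.symm
    exact ⟨Units.mk0 a ha0, Units.ext ha'⟩

/-- An element of the image of the quaternions commuting with the generators is a scalar. -/
theorem exists_eq_smul_one_of_mem_range_quatHom {x : A} (hx : x ∈ (quatHom hi hj hij).range)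
    (hxi : x * i = i * x) (hxj : x * j = j * x) : ∃ r : ℚ, x = r • (1 : A) := by
  obtain ⟨a, ha⟩ := hx
  have ha' : quatHom hi hj hij a = x := ha
  refine ⟨a.re, ?_⟩
  have h1 : ∀ y, i * (i * y) = -y := fun y => by rw [← mul_assoc, hi]; simp
  have h3 : ∀ y, j * (i * y) = -(i * (j * y)) := fun y => by
    rw [← mul_assoc, hij]; simp [mul_assoc]
  have hx4 : (4 : ℚ) • x = x - x * i * i - x * j * j - x * i * j * (i * j) := by
    have e1 : x * i * i = -x := by rw [mul_assoc, hi]; simp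
    have e2 : x * j * j = -x := by rw [mul_assoc, hj]; simp
    have e3 : x * i * j * (i * j) = -x := by
      simp only [mul_assoc, h3, hj]; simp [hi]
    rw [e1, e2, e3]; module
  have e4 : x * i * j * (i * j) = i * j * x * (i * j) := by
    rw [hxi, mul_assoc i x j, hxj, ← mul_assoc i j x]
  rw [e4, hxi, hxj] at hx4
  have : (4 : ℚ) • x = (4 : ℚ) • a.re • (1 : A) := by
    rw [hx4, ← ha', quatHom_apply]
    simp only [mul_add, add_mul, mul_smul_comm, smul_mul_assoc, mul_assoc, mul_one, one_mul,
      h1, h3, hi, hj, hij, mul_neg, neg_mul, neg_neg, smul_neg]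
    module
  have h4 : (4 : ℚ) ≠ 0 := by norm_num
  simpa using congrArg (fun y => (4 : ℚ)⁻¹ • y) this

end QuaternionHom

namespace HasQuaternionFitting

variable {G N : Subgroup (GL (Fin 4 ⊕ Fin 4) ℚ)} {i j : GL (Fin 4 ⊕ Fin 4) ℚ}

theorem ne_neg (x : GL (Fin 4 ⊕ Fin 4) ℚ) : x ≠ -x := by
  intro h
  have h1 : x.1 = -x.1 := congrArg Units.val h
  refine x.ne_zero ?_
  ext r s
  have h2 := congrFun (congrFun h1 r) s
  rw [Matrix.neg_apply] at h2
  exact self_eq_neg.1 h2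

variable (h : HasQuaternionFitting G N i j)
include h

theorem eq_one_or_eq_neg_one {x : GL (Fin 4 ⊕ Fin 4) ℚ} (hx : x ∈ N) (hxi : x * i = i * x)
    (hxj : x * j = j * x) : x = 1 ∨ x = -1 := by
  have hji := h.j_mul_i
  have e : ∀ y, j * (i * y) = -(i * (j * y)) := fun y => by
    rw [← mul_assoc, hji]; simp [mul_assoc]
  rcases h.mem x hx with rfl | rfl | rfl | rfl | rfl | rfl | rfl | rfl
  · exact Or.inl rfl
  · exact Or.inr rfl
  · exact absurd (hxj.trans hji) (ne_neg _)
  · exact absurd (hxj.trans (by simp [hji])) (ne_neg _)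
  · exact absurd (hxi.symm.trans (by simp [hji])) (ne_neg _)
  · exact absurd (hxi.symm.trans (by simp [hji])) (ne_neg _)
  · refine absurd (hxi.symm.trans ?_) (ne_neg _); simp [mul_assoc, hji]
  · refine absurd (hxi.symm.trans ?_) (ne_neg _); simp [mul_assoc, hji]

theorem neg_one_mem : (-1 : GL (Fin 4 ⊕ Fin 4) ℚ) ∈ N := h.i_sq ▸ N.mul_mem h.i_mem h.i_mem

theorem no_complex_structure {X : Matrix (Fin 4 ⊕ Fin 4) (Fin 4 ⊕ Fin 4) ℚ} (hX : X * X = -1)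
    (hc : ∀ g ∈ G, Commute X (g : Matrix (Fin 4 ⊕ Fin 4) (Fin 4 ⊕ Fin 4) ℚ)) : False := by
  let x : GL (Fin 4 ⊕ Fin 4) ℚ := ⟨X, -X, by simp [hX], by simp [hX]⟩
  have hx2 : x * x = -1 := Units.ext hX
  have hxG : ∀ g ∈ G, g * x = x * g := fun g hg => Units.ext (hc g hg).eq.symm
  have hfin : (Subgroup.zpowers x : Set (GL (Fin 4 ⊕ Fin 4) ℚ)).Finite := by
    have : IsOfFinOrder x := isOfFinOrder_iff_pow_eq_one.2 ⟨4, by norm_num, by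
      simp [pow_succ, hx2]⟩
    exact this.finite_zpowers
  have hn : ∀ g ∈ G, ∀ s ∈ Subgroup.zpowers x, g * s * g⁻¹ ∈ Subgroup.zpowers x := by
    rintro g hg s ⟨k, rfl⟩
    have : Commute g (x ^ k) := Commute.zpow_right (hxG g hg) k
    refine ⟨k, ?_⟩
    change x ^ k = g * x ^ k * g⁻¹
    rw [this.eq, mul_inv_cancel_right]
  obtain ⟨F, hF, hFp, hFG⟩ := exists_invariant_form (sup_finite_of_normalizes h.finite hfin hn)
  have hxF : X * F * Xᵀ = F := hFG x (Subgroup.mem_sup_right (Subgroup.mem_zpowers x))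
  have hXF : F * Xᵀ = -(X * F) := by
    conv_rhs => rw [← hxF, ← Matrix.mul_assoc, ← Matrix.mul_assoc, hX]
    simp
  have hle : Subgroup.zpowers x ≤ G := by
    refine le_of_maximal_symplectic (A := X * F) h.finite h.maximal hfin hn ?_ ?_ ?_ ?_
    · rw [Matrix.transpose_mul, hF, hXF]
    · exact (Units.isUnit x).mul (isUnit_of_form_pos hFp)
    · intro g hg
      rw [← Matrix.mul_assoc, ← (hc g hg).eq, Matrix.mul_assoc, Matrix.mul_assoc,
        ← Matrix.mul_assoc _ F, hFG g (Subgroup.mem_sup_left hg)]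
    · rintro s ⟨k, rfl⟩
      have hk : Commute X (x ^ k).1 :=
        congrArg Units.val ((Commute.refl x).zpow_right k).eq
      change (x ^ k).1 * _ *
        (x ^ k).1ᵀ = _
      rw [← Matrix.mul_assoc, ← hk.eq, Matrix.mul_assoc, Matrix.mul_assoc, ← Matrix.mul_assoc _ F,
        hFG _ (Subgroup.mem_sup_right ⟨k, rfl⟩)]
  have hxN : x ∈ N := h.nilpotent_le _ hle hn (isNilpotent_zpowers _) (Subgroup.mem_zpowers x)
  rcases h.eq_one_or_eq_neg_one hxN (hxG i (h.le h.i_mem)).symm (hxG j (h.le h.j_mem)).symm with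
    hx | hx <;> rw [hx] at hx2 <;> exact ne_neg 1 (by simpa using hx2)

theorem val_i_sq : i.1 * i.1 = -1 := congrArg Units.val h.i_sq
theorem val_j_sq : j.1 * j.1 = -1 := congrArg Units.val h.j_sq
theorem val_j_mul_i : j.1 * i.1 = -(i.1 * j.1) := congrArg Units.val h.j_mul_i

theorem mem_range_of_mem {x : GL (Fin 4 ⊕ Fin 4) ℚ} (hx : x ∈ N) :
    x.1 ∈ (quatHom h.val_i_sq h.val_j_sq h.val_j_mul_i).range := by
  have hi := i_mem_range_quatHom h.val_i_sq h.val_j_sq h.val_j_mul_i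
  have hj := j_mem_range_quatHom h.val_i_sq h.val_j_sq h.val_j_mul_i
  rcases h.mem x hx with rfl | rfl | rfl | rfl | rfl | rfl | rfl | rfl
  · exact one_mem _
  · exact neg_mem (one_mem _)
  · exact hi
  · exact neg_mem hi
  · exact hj
  · exact neg_mem hj
  · exact mul_mem hi hj
  · exact neg_mem (mul_mem hi hj)

/-- The image of the rational quaternions is normalized by `G`. -/
theorem conj_mem_range {g : GL (Fin 4 ⊕ Fin 4) ℚ} (hg : g ∈ G)
    {x : Matrix (Fin 4 ⊕ Fin 4) (Fin 4 ⊕ Fin 4) ℚ}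
    (hx : x ∈ (quatHom h.val_i_sq h.val_j_sq h.val_j_mul_i).range) :
    g.1 * x * (g⁻¹).1 ∈ (quatHom h.val_i_sq h.val_j_sq h.val_j_mul_i).range := by
  have hN : ∀ x ∈ N, g.1 * x.1 * (g⁻¹).1 ∈
      (quatHom h.val_i_sq h.val_j_sq h.val_j_mul_i).range := fun x hx =>
    h.mem_range_of_mem (h.normal g hg x hx)
  obtain ⟨a, ha⟩ := hx
  have ha' : quatHom h.val_i_sq h.val_j_sq h.val_j_mul_i a = x := ha
  rw [← ha', quatHom_apply]
  simp only [mul_add, add_mul, mul_smul_comm, smul_mul_assoc]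
  exact add_mem (add_mem (add_mem (Subalgebra.smul_mem _ (hN 1 N.one_mem) _)
    (Subalgebra.smul_mem _ (hN i h.i_mem) _)) (Subalgebra.smul_mem _ (hN j h.j_mem) _))
    (Subalgebra.smul_mem _ (hN (i * j) (N.mul_mem h.i_mem h.j_mem)) _)

open scoped Quaternion in
/-- A matrix in the image of the rational quaternions that normalizes `N` and preserves the
symplectic form of `G` lies in `G`. -/
theorem mem_of_mem_range {A : Matrix (Fin 4 ⊕ Fin 4) (Fin 4 ⊕ Fin 4) ℚ} (hA : Aᵀ = -A)
    (hAu : IsUnit A) (hGA : ∀ g ∈ G, g.1 * A * g.1ᵀ = A) {w : GL (Fin 4 ⊕ Fin 4) ℚ}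
    (hw : w.1 ∈ (quatHom h.val_i_sq h.val_j_sq h.val_j_mul_i).range)
    (hwN : w ∈ Subgroup.normalizer (N : Set (GL (Fin 4 ⊕ Fin 4) ℚ)))
    (hwA : w.1 * A * w.1ᵀ = A) : w ∈ G := by
  let K : Subgroup (GL (Fin 4 ⊕ Fin 4) ℚ) :=
    { carrier := {s | s.1 * A * s.1ᵀ = A}
      mul_mem' := by
        intro s t hs ht
        change (s.1 * t.1) * A * (s.1 * t.1)ᵀ = A
        rw [Matrix.transpose_mul, ← Matrix.mul_assoc, Matrix.mul_assoc s.1, Matrix.mul_assoc s.1,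
          show t.1 * A * t.1ᵀ = A from ht, show s.1 * A * s.1ᵀ = A from hs]
      one_mem' := by simp
      inv_mem' := by
        intro s hs
        change (s⁻¹).1 * A * (s⁻¹).1ᵀ = A
        conv_lhs => rw [← show s.1 * A * s.1ᵀ = A from hs, Matrix.mul_assoc s.1,
          ← Matrix.mul_assoc, Units.inv_mul, Matrix.one_mul, Matrix.mul_assoc,
          ← Matrix.transpose_mul, Units.inv_mul, Matrix.transpose_one, Matrix.mul_one] }
  let S : Subgroup (GL (Fin 4 ⊕ Fin 4) ℚ) :=
    (Units.map (quatHom h.val_i_sq h.val_j_sq h.val_j_mul_i :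
      ℍ[ℚ] →* Matrix (Fin 4 ⊕ Fin 4) (Fin 4 ⊕ Fin 4) ℚ)).range ⊓
      Subgroup.normalizer (N : Set (GL (Fin 4 ⊕ Fin 4) ℚ)) ⊓ K
  have hGN : G ≤ Subgroup.normalizer (N : Set (GL (Fin 4 ⊕ Fin 4) ℚ)) :=
    Subgroup.le_normalizer_iff.2 h.normal
  have hGK : G ≤ K := hGA
  have hS : ∀ s, s ∈ S ↔ (s.1 ∈ (quatHom h.val_i_sq h.val_j_sq h.val_j_mul_i).range ∧
      s ∈ Subgroup.normalizer (N : Set (GL (Fin 4 ⊕ Fin 4) ℚ))) ∧ s ∈ K := fun s => by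
    rw [Subgroup.mem_inf, Subgroup.mem_inf, mem_range_units_map_quatHom]
  have hSn : ∀ g ∈ G, ∀ s ∈ S, g * s * g⁻¹ ∈ S := by
    intro g hg s hs
    obtain ⟨⟨h1, h2⟩, h3⟩ := (hS s).1 hs
    refine (hS _).2 ⟨⟨h.conj_mem_range hg h1, ?_⟩, ?_⟩
    · exact mul_mem (mul_mem (hGN hg) h2) (inv_mem (hGN hg))
    · exact mul_mem (mul_mem (hGK hg) h3) (inv_mem (hGK hg))
  have hNfin : (N : Set (GL (Fin 4 ⊕ Fin 4) ℚ)).Finite := h.finite.subset h.le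
  have hSfin : (S : Set (GL (Fin 4 ⊕ Fin 4) ℚ)).Finite := by
    refine Set.Finite.of_finite_fibers (f := fun s => (s * i * s⁻¹, s * j * s⁻¹)) ?_ ?_
    · refine (hNfin.prod hNfin).subset ?_
      rintro _ ⟨s, hs, rfl⟩
      have h2' := Subgroup.mem_normalizer_iff.1 ((hS s).1 hs).1.2
      exact ⟨(h2' i).1 h.i_mem, (h2' j).1 h.j_mem⟩
    · rintro _ ⟨s, hs, rfl⟩
      refine (Set.toFinite {s, -s}).subset ?_
      rintro t ⟨ht, hts⟩
      have hts1 : t * i * t⁻¹ = s * i * s⁻¹ := congrArg Prod.fst hts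
      have hts2 : t * j * t⁻¹ = s * j * s⁻¹ := congrArg Prod.snd hts
      have hz : s⁻¹ * t ∈ S := mul_mem (inv_mem hs) ht
      have hzi : (s⁻¹ * t) * i = i * (s⁻¹ * t) := by
        rw [mul_assoc, eq_mul_of_mul_inv_eq hts1]; group
      have hzj : (s⁻¹ * t) * j = j * (s⁻¹ * t) := by
        rw [mul_assoc, eq_mul_of_mul_inv_eq hts2]; group
      obtain ⟨⟨hz1, -⟩, hz3⟩ := (hS _).1 hz
      obtain ⟨r, hr⟩ := exists_eq_smul_one_of_mem_range_quatHom _ _ _ hz1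
        (congrArg Units.val hzi) (congrArg Units.val hzj)
      have hz4 : (s⁻¹ * t).1 * A * (s⁻¹ * t).1ᵀ = A := hz3
      rw [hr] at hz4
      have hr2 : r * r = 1 := by
        have : (r * r) • A = (1 : ℚ) • A := by
          rw [one_smul]; conv_rhs => rw [← hz4]
          simp [smul_smul]
        exact smul_left_injective ℚ hAu.ne_zero this
      rcases mul_self_eq_one_iff.1 hr2 with rfl | rfl
      · left
        exact (inv_mul_eq_one.1 (Units.ext (by simpa using hr) : s⁻¹ * t = 1)).symm
      · right
        have : s⁻¹ * t = -1 := Units.ext (by simpa using hr)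
        rw [inv_mul_eq_iff_eq_mul.1 this]; simp
  exact le_of_maximal_symplectic h.finite h.maximal hSfin hSn hA hAu hGA (fun s hs => hs.2)
    ((hS w).2 ⟨⟨hw, hwN⟩, hwA⟩)

end HasQuaternionFitting

theorem mul_form_eq_neg {n : Type*} [Fintype n] [DecidableEq n] {g A : Matrix n n ℚ}
    (h : g * A * gᵀ = A) (hg : g * g = -1) : g * A = -(A * gᵀ) := by
  conv_lhs => rw [← h, ← Matrix.mul_assoc, ← Matrix.mul_assoc, hg]
  simp

namespace HasQuaternionFitting

variable {G N : Subgroup (GL (Fin 4 ⊕ Fin 4) ℚ)} {i j : GL (Fin 4 ⊕ Fin 4) ℚ}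
  (h : HasQuaternionFitting G N i j)
include h

/-- `G` contains the Hurwitz unit permuting `i`, `j` and `ij` cyclically. -/
theorem exists_hurwitz_unit : ∃ w ∈ G,
    w.1 ∈ (quatHom h.val_i_sq h.val_j_sq h.val_j_mul_i).range ∧ w * i = i * j * w ∧
      w * j = i * w := by
  have hi := h.val_i_sq
  have hj := h.val_j_sq
  have hji := h.val_j_mul_i
  have h1 : ∀ y, i.1 * (i.1 * y) = -y := fun y => by rw [← mul_assoc, hi]; simp
  have h3 : ∀ y, j.1 * (i.1 * y) = -(i.1 * (j.1 * y)) := fun y => by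
    rw [← mul_assoc, hji]; simp [mul_assoc]
  obtain ⟨W, hW⟩ : ∃ W, W = (2⁻¹ : ℚ) • (-1 + i.1 + j.1 + i.1 * j.1) := ⟨_, rfl⟩
  obtain ⟨V, hV⟩ : ∃ V, V = (2⁻¹ : ℚ) • (-1 - i.1 - j.1 - i.1 * j.1) := ⟨_, rfl⟩
  have hWV : W * V = 1 := by
    simp only [hW, hV, smul_mul_smul_comm, add_mul, mul_sub, mul_neg, neg_mul,
      mul_assoc, mul_one, one_mul, h1, h3, hi, hj, hji, neg_neg]
    module
  have hVW : V * W = 1 := mul_eq_one_comm.1 hWV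
  have hWW : W * W = V := by
    simp only [hW, hV, smul_mul_smul_comm, mul_add, add_mul, mul_neg, neg_mul,
      mul_assoc, mul_one, one_mul, h1, h3, hi, hj, hji, neg_neg]
    module
  let w : GL (Fin 4 ⊕ Fin 4) ℚ := ⟨W, V, hWV, hVW⟩
  have hwi : w * i = i * j * w := by
    ext1
    change W * i.1 = i.1 * j.1 * W
    simp only [hW, smul_mul_assoc, mul_smul_comm, mul_add, add_mul, mul_neg, neg_mul,
      mul_assoc, mul_one, one_mul, h1, h3, hi, hj, hji, neg_neg]
    module
  have hwj : w * j = i * w := by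
    ext1
    change W * j.1 = i.1 * W
    simp only [hW, smul_mul_assoc, mul_smul_comm, mul_add, add_mul, mul_neg, neg_mul,
      mul_assoc, mul_one, one_mul, h1, hi, hj]
    module
  have hwk : w * (i * j) = j * w := by
    ext1
    change W * (i.1 * j.1) = j.1 * W
    simp only [hW, smul_mul_assoc, mul_smul_comm, mul_add, add_mul, mul_neg, neg_mul,
      mul_assoc, mul_one, one_mul, h1, h3, hi, hj, hji, neg_neg]
    module
  have hw3 : w⁻¹ = w * w := Units.ext hWW.symm
  have hwr : w.1 ∈ (quatHom h.val_i_sq h.val_j_sq h.val_j_mul_i).range := by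
    have hi' := i_mem_range_quatHom h.val_i_sq h.val_j_sq h.val_j_mul_i
    have hj' := j_mem_range_quatHom h.val_i_sq h.val_j_sq h.val_j_mul_i
    change W ∈ _
    rw [hW]
    exact Subalgebra.smul_mem _ (add_mem (add_mem (add_mem (neg_mem (one_mem _)) hi') hj')
      (mul_mem hi' hj')) _
  have hwN : ∀ x ∈ N, w * x * w⁻¹ ∈ N := by
    have hiN := h.i_mem
    have hjN := h.j_mem
    have hm := h.neg_one_mem
    have hneg : ∀ x ∈ N, -x ∈ N := fun x hx => by simpa using N.mul_mem hm hx
    have ei : w * i * w⁻¹ = i * j := mul_inv_eq_of_eq_mul hwi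
    have ej : w * j * w⁻¹ = i := mul_inv_eq_of_eq_mul hwj
    have ek : w * (i * j) * w⁻¹ = j := mul_inv_eq_of_eq_mul hwk
    intro x hx
    rcases h.mem x hx with rfl | rfl | rfl | rfl | rfl | rfl | rfl | rfl
    · simp
    · simpa using hm
    · rw [ei]; exact N.mul_mem hiN hjN
    · rw [mul_neg, neg_mul, ei]; exact hneg _ (N.mul_mem hiN hjN)
    · rw [ej]; exact hiN
    · rw [mul_neg, neg_mul, ej]; exact hneg _ hiN
    · rw [ek]; exact hjN
    · rw [mul_neg, neg_mul, ek]; exact hneg _ hjN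
  obtain ⟨A, hA, hAu, hGA⟩ := h.symplectic
  refine ⟨w, h.mem_of_mem_range hA hAu hGA hwr
    (Subgroup.mem_normalizer_iff.2 fun x => ⟨hwN x, fun hx => ?_⟩)
    ?_, hwr, hwi, hwj⟩
  · have := hwN _ (hwN _ hx)
    have e : w * (w * (w * x * w⁻¹) * w⁻¹) * w⁻¹ = x := by
      have e1 : w * (w * (w * x * w⁻¹) * w⁻¹) * w⁻¹ = (w * w) * w * x * w⁻¹ * (w * w)⁻¹ := by group
      rw [e1, ← hw3]; group
    rwa [e] at this
  · change W * A * Wᵀ = A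
    have e1 := mul_form_eq_neg (hGA i (h.le h.i_mem)) hi
    have e2 := mul_form_eq_neg (hGA j (h.le h.j_mem)) hj
    have e3 := mul_form_eq_neg (hGA _ (h.le (N.mul_mem h.i_mem h.j_mem))) (by
      simp [mul_assoc, h3, hj, hi] : (i * j).1 * (i * j).1 = -1)
    have e : W * A = A * Vᵀ := by
      rw [Units.val_mul] at e3
      simp only [hW, hV, smul_mul_assoc, add_mul, e1, e2, e3, Matrix.transpose_smul,
        Matrix.transpose_sub, Matrix.transpose_neg, Matrix.transpose_one, mul_smul_comm, mul_sub,
        mul_neg, mul_one, neg_mul, one_mul]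
      module
    rw [e, Matrix.mul_assoc, ← Matrix.transpose_mul, hWV, Matrix.transpose_one, Matrix.mul_one]

/-- Up to a factor in the quaternions, every element of `G` commutes with `i` and either commutes
with `j` or takes it to `ij`. -/
theorem exists_mul_commute {g : GL (Fin 4 ⊕ Fin 4) ℚ} (hg : g ∈ G) : ∃ u ∈ G,
    u.1 ∈ (quatHom h.val_i_sq h.val_j_sq h.val_j_mul_i).range ∧ u * g * i = i * (u * g) ∧
      (u * g * j = j * (u * g) ∨ u * g * j = i * j * (u * g)) := by
  obtain ⟨w, hwG, hwr, hwi, hwj⟩ := h.exists_hurwitz_unit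
  have hiG := h.le h.i_mem
  have hjG := h.le h.j_mem
  have hir := i_mem_range_quatHom h.val_i_sq h.val_j_sq h.val_j_mul_i
  have hjr := j_mem_range_quatHom h.val_i_sq h.val_j_sq h.val_j_mul_i
  have hji := h.j_mul_i
  have e : ∀ y, j * (i * y) = -(i * (j * y)) := fun y => by
    rw [← mul_assoc, hji]; simp [mul_assoc]
  have hwk : w * (i * j) = j * w := by
    have : w * (i * j) = i * (j * i) * w := by
      rw [← mul_assoc, hwi, mul_assoc, hwj]; simp only [mul_assoc]
    rw [this, hji, mul_neg, ← mul_assoc, h.i_sq]; simp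
  have hstep1 : ∀ x ∈ N, x * x = -1 → ∃ u ∈ G,
      u.1 ∈ (quatHom h.val_i_sq h.val_j_sq h.val_j_mul_i).range ∧ u * x = i * u := by
    intro x hx hx2
    rcases h.mem x hx with rfl | rfl | rfl | rfl | rfl | rfl | rfl | rfl
    · exact absurd (by simpa using hx2) (ne_neg 1)
    · exact absurd (by simpa using hx2) (ne_neg 1)
    · exact ⟨1, G.one_mem, one_mem _, by simp⟩
    · exact ⟨j, hjG, hjr, by simp [hji]⟩
    · exact ⟨w, hwG, hwr, hwj⟩
    · exact ⟨j * w, mul_mem hjG hwG, mul_mem hjr hwr, by simp [mul_assoc, hwj, e]⟩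
    · exact ⟨w * w, mul_mem hwG hwG, mul_mem hwr hwr, by
        rw [mul_assoc, hwk, ← mul_assoc, hwj, mul_assoc]⟩
    · refine ⟨j * (w * w), mul_mem hjG (mul_mem hwG hwG), mul_mem hjr (mul_mem hwr hwr), ?_⟩
      have : w * w * (i * j) = i * (w * w) := by rw [mul_assoc, hwk, ← mul_assoc, hwj, mul_assoc]
      rw [mul_neg, mul_assoc, this, e, neg_neg]
  have hsq : ∀ x : GL (Fin 4 ⊕ Fin 4) ℚ, x * x = -1 → ∀ y, y * x * y⁻¹ * (y * x * y⁻¹) = -1 := by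
    intro x hx y
    have : y * x * y⁻¹ * (y * x * y⁻¹) = y * (x * x) * y⁻¹ := by group
    rw [this, hx]; simp
  obtain ⟨u, huG, hur, hu⟩ := hstep1 _ (h.normal g hg i h.i_mem) (hsq _ h.i_sq _)
  have hui : u * g * i = i * (u * g) := by
    rw [← mul_assoc i, ← hu]; group
  have hq := h.normal _ (mul_mem huG hg) j h.j_mem
  have hq2 := hsq _ h.j_sq (u * g)
  have hqi : u * g * j * (u * g)⁻¹ * i = -(i * (u * g * j * (u * g)⁻¹)) := by
    have e1 : (u * g)⁻¹ * i = i * (u * g)⁻¹ := by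
      rw [inv_mul_eq_iff_eq_mul, ← mul_assoc, hui]; group
    rw [mul_assoc, e1, mul_assoc (u * g), e]
    rw [mul_neg, ← mul_assoc (u * g) i, hui]
    simp only [mul_assoc]
  have hgen : ∀ y, u * g * j * (u * g)⁻¹ = y → u * g * j = y * (u * g) := fun y hy =>
    eq_mul_of_mul_inv_eq hy
  have hneg : ∀ y, u * g * j = -(y * (u * g)) →
      i * y = -(y * i) → i * (u * g) * j = y * (i * (u * g)) := by
    intro y hy hiy
    rw [mul_assoc, hy, mul_neg, ← mul_assoc, hiy]; simp [mul_assoc]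
  have hii : i * (u * g) * i = i * (i * (u * g)) := by rw [mul_assoc, hui]
  have hk1 : i * j = -(j * i) := by rw [hji, neg_neg]
  have hk2 : i * (i * j) = -(i * j * i) := by rw [mul_assoc, hji]; simp
  rcases h.mem _ hq with hx | hx | hx | hx | hx | hx | hx | hx
  · rw [hx] at hq2; exact absurd (by simpa using hq2) (ne_neg 1)
  · rw [hx] at hq2; exact absurd (by simpa using hq2) (ne_neg 1)
  · rw [hx] at hqi; exact absurd hqi (ne_neg _)
  · rw [hx] at hqi; exact absurd (by simpa using hqi.symm) (ne_neg (i * i))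
  · exact ⟨u, huG, hur, hui, Or.inl (hgen _ hx)⟩
  · refine ⟨i * u, mul_mem hiG huG, mul_mem hir hur, ?_, Or.inl ?_⟩
    · rwa [mul_assoc i u g]
    · rw [mul_assoc i u g]; exact hneg j (by rw [hgen _ hx, neg_mul]) hk1
  · exact ⟨u, huG, hur, hui, Or.inr (hgen _ hx)⟩
  · refine ⟨i * u, mul_mem hiG huG, mul_mem hir hur, ?_, Or.inr ?_⟩
    · rwa [mul_assoc i u g]
    · rw [mul_assoc i u g]; exact hneg (i * j) (by rw [hgen _ hx, neg_mul]) hk2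

end HasQuaternionFitting

section ComplexStructure

open scoped Quaternion

variable {n : Type*} [Fintype n] [DecidableEq n] {i j c : Matrix n n ℚ}

theorem commute_quatHom {A : Type*} [Ring A] [Algebra ℚ A] {i j c : A} (hi : i * i = -1)
    (hj : j * j = -1) (hij : j * i = -(i * j)) (hci : Commute c i) (hcj : Commute c j)
    (a : ℍ[ℚ]) : Commute c (quatHom hi hj hij a) := by
  rw [quatHom_apply]
  exact ((((Commute.one_right c).smul_right _).add_right (hci.smul_right _)).add_right
    (hcj.smul_right _)).add_right ((hci.mul_right hcj).smul_right _)

/-- A module of rank two over the rational quaternions, generated by `v` and `v c`, has a complex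
structure commuting with the quaternions and with `c`. -/
theorem exists_complex_structure (hn : Fintype.card n = 8) (hi : i * i = -1) (hj : j * j = -1)
    (hij : j * i = -(i * j)) (hci : Commute c i) (hcj : Commute c j) {ρ : ℚ}
    (hc : c * c = ρ • 1) {v : n → ℚ} (hv : v ≠ 0)
    (hvc : ∀ a, v ᵥ* c ≠ v ᵥ* quatHom hi hj hij a) :
    ∃ X : Matrix n n ℚ, X * X = -1 ∧ (∀ a, Commute X (quatHom hi hj hij a)) ∧ Commute X c := by
  have hcq := commute_quatHom hi hj hij hci hcj
  obtain ⟨f, hf⟩ : ∃ f, f = quatHom hi hj hij := ⟨_, rfl⟩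
  rw [← hf] at hvc hcq ⊢
  let Φ : ℍ[ℚ] × ℍ[ℚ] →ₗ[ℚ] n → ℚ :=
    { toFun := fun p => v ᵥ* (f p.1 + c * f p.2)
      map_add' := fun p q => by
        rw [← Matrix.vecMul_add]; congr 1
        simp only [Prod.fst_add, Prod.snd_add, map_add, mul_add]; abel
      map_smul' := fun r p => by
        rw [RingHom.id_apply, ← Matrix.vecMul_smul]; congr 1
        simp only [Prod.smul_fst, Prod.smul_snd, map_smul, mul_smul_comm, smul_add] }
  have hΦ : ∀ p, Φ p = v ᵥ* (f p.1 + c * f p.2) := fun _ => rfl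
  have hinv : ∀ (a : ℍ[ℚ]) (w : n → ℚ), a ≠ 0 → w ᵥ* f a ᵥ* f a⁻¹ = w := fun a w ha => by
    rw [vecMul_vecMul, ← map_mul, mul_inv_cancel₀ ha, map_one, vecMul_one]
  have hinj : Function.Injective Φ := by
    rw [← LinearMap.ker_eq_bot, LinearMap.ker_eq_bot']
    rintro ⟨a, b⟩ hp
    rw [hΦ, Matrix.vecMul_add, ← vecMul_vecMul] at hp
    dsimp only at hp
    have hb : b = 0 := by
      by_contra hb
      refine hvc (-(a * b⁻¹)) ?_
      rw [← hinv b (v ᵥ* c) hb, eq_neg_of_add_eq_zero_right hp, map_neg, map_mul,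
        Matrix.neg_vecMul, vecMul_vecMul, Matrix.vecMul_neg]
    subst hb
    have ha : a = 0 := by
      by_contra ha
      refine hv ?_
      rw [map_zero, Matrix.vecMul_zero, add_zero] at hp
      rw [← hinv a v ha, hp, zero_vecMul]
    rw [ha]; rfl
  have hdim : Module.finrank ℚ (ℍ[ℚ] × ℍ[ℚ]) = Module.finrank ℚ (n → ℚ) := by
    rw [Module.finrank_prod, Quaternion.finrank_eq_four, Module.finrank_fintype_fun_eq_card, hn]
  have : Module.Finite ℚ ℍ[ℚ] := Module.finite_of_finrank_pos (by
    rw [Quaternion.finrank_eq_four]; norm_num)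
  let e := LinearEquiv.ofInjectiveOfFinrankEq Φ hinj hdim
  have he : ∀ p, e p = Φ p := fun p => rfl
  let q : ℍ[ℚ] := ⟨0, 1, 0, 0⟩
  have hq : q * q = -1 := by
    refine (QuaternionAlgebra.mk_mul_mk ..).trans ?_
    ext <;> simp
  let X := LinearMap.toMatrixRight' (e.toLinearMap ∘ₗ
    ((LinearMap.mulLeft ℚ q).prodMap (LinearMap.mulLeft ℚ q)) ∘ₗ e.symm.toLinearMap)
  have hX : ∀ p, Φ p ᵥ* X = Φ (q * p.1, q * p.2) := by
    intro p
    rw [← Matrix.toLinearMapRight'_apply, LinearEquiv.symm_apply_apply]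
    simp [← he]
  have hext : ∀ A B : Matrix n n ℚ, (∀ p, Φ p ᵥ* A = Φ p ᵥ* B) → A = B := by
    intro A B hAB
    rw [Matrix.ext_iff_vecMul]
    intro w
    obtain ⟨p, rfl⟩ := e.surjective w
    exact hAB p
  have hqq : ∀ a : ℍ[ℚ], q * (q * a) = -a := fun a => by rw [← mul_assoc, hq, neg_one_mul]
  refine ⟨X, hext _ _ fun p => ?_, fun d => hext _ _ fun p => ?_, hext _ _ fun p => ?_⟩
  · rw [← vecMul_vecMul, hX, hX, hqq, hqq, Matrix.vecMul_neg, vecMul_one, ← map_neg]; rfl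
  · have hd : ∀ p, Φ p ᵥ* f d = Φ (p.1 * d, p.2 * d) := fun p => by
      rw [hΦ, hΦ, vecMul_vecMul, add_mul, mul_assoc, map_mul, map_mul]
    rw [← vecMul_vecMul, ← vecMul_vecMul, hX, hd, hd, hX, mul_assoc, mul_assoc]
  · have hd : ∀ p, Φ p ᵥ* c = Φ (ρ • p.2, p.1) := fun p => by
      rw [hΦ, hΦ, vecMul_vecMul]
      dsimp only
      rw [add_mul, mul_assoc, ← (hcq p.2).eq, ← mul_assoc, hc, (hcq p.1).eq, map_smul,
        smul_one_mul, add_comm]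
    rw [← vecMul_vecMul, ← vecMul_vecMul, hX, hd, hd, hX, mul_smul_comm]

end ComplexStructure

namespace HasQuaternionFitting

variable {G N : Subgroup (GL (Fin 4 ⊕ Fin 4) ℚ)} {i j : GL (Fin 4 ⊕ Fin 4) ℚ}
  (h : HasQuaternionFitting G N i j)
include h

/-- If the centralizer of `i` and `j` in `G` is `{±1}`, then `G` generates an algebra of rank at
most two over the quaternions. -/
theorem exists_generator (hC : ∀ c ∈ G, c * i = i * c → c * j = j * c → c = 1 ∨ c = -1) :
    ∃ (c : Matrix (Fin 4 ⊕ Fin 4) (Fin 4 ⊕ Fin 4) ℚ) (ρ : ℚ), Commute c i.1 ∧ Commute c j.1 ∧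
      c * c = ρ • 1 ∧ ∀ g ∈ G, g.1 ∈ (quatHom h.val_i_sq h.val_j_sq h.val_j_mul_i).range ∨
        ∃ a ∈ (quatHom h.val_i_sq h.val_j_sq h.val_j_mul_i).range, g.1 = a * c := by
  have hi := h.val_i_sq
  have hir := i_mem_range_quatHom h.val_i_sq h.val_j_sq h.val_j_mul_i
  have hinv : ∀ u : GL (Fin 4 ⊕ Fin 4) ℚ,
      u.1 ∈ (quatHom h.val_i_sq h.val_j_sq h.val_j_mul_i).range →
      (u⁻¹).1 ∈ (quatHom h.val_i_sq h.val_j_sq h.val_j_mul_i).range := fun u hu =>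
    (mem_range_units_map_quatHom _ _ _).1
      (inv_mem ((mem_range_units_map_quatHom _ _ _).2 hu))
  have hcomm : ∀ g u : GL (Fin 4 ⊕ Fin 4) ℚ,
      u.1 ∈ (quatHom h.val_i_sq h.val_j_sq h.val_j_mul_i).range → u * g = 1 ∨ u * g = -1 →
      g.1 ∈ (quatHom h.val_i_sq h.val_j_sq h.val_j_mul_i).range := by
    rintro g u hu (hug | hug)
    · rw [← inv_eq_iff_mul_eq_one.2 hug]; exact hinv _ hu
    · rw [eq_inv_mul_of_mul_eq hug, mul_neg, mul_one]; exact neg_mem (hinv _ hu)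
  by_cases ht : ∃ t ∈ G, t * i = i * t ∧ t * j = i * j * t
  · obtain ⟨t, htG, hti, htj⟩ := ht
    have hti' : t.1 * i.1 = i.1 * t.1 := congrArg Units.val hti
    have htj' : t.1 * j.1 = i.1 * j.1 * t.1 := congrArg Units.val htj
    have h1 : ∀ y, i.1 * (i.1 * y) = -y := fun y => by rw [← mul_assoc, hi]; simp
    have h3 : ∀ y, j.1 * (i.1 * y) = -(i.1 * (j.1 * y)) := fun y => by
      rw [← mul_assoc, h.val_j_mul_i]; simp [mul_assoc]
    have h4 : ∀ y, t.1 * (i.1 * y) = i.1 * (t.1 * y) := fun y => by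
      rw [← mul_assoc, hti', mul_assoc]
    obtain ⟨c, hc⟩ : ∃ c, c = (2⁻¹ : ℚ) • (t.1 - i.1 * t.1) := ⟨_, rfl⟩
    have htc : t.1 = (1 + i.1) * c := by
      simp only [hc, mul_smul_comm, add_mul, mul_sub, one_mul, h1]; module
    have hci : Commute c i.1 := by
      change c * i.1 = i.1 * c
      simp only [hc, mul_smul_comm, smul_mul_assoc, mul_sub, sub_mul, mul_assoc, hti', h1]
    have hcj : Commute c j.1 := by
      change c * j.1 = j.1 * c
      simp only [hc, mul_smul_comm, smul_mul_assoc, mul_sub, sub_mul, mul_assoc, htj', h1, h3]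
      module
    have hcc : c * c = -(2⁻¹ : ℚ) • (i.1 * (t.1 * t.1)) := by
      simp only [hc, mul_smul_comm, smul_mul_assoc, mul_sub, sub_mul, mul_assoc, h1, h4]
      module
    have hs : i * (t * t) = 1 ∨ i * (t * t) = -1 := by
      refine hC _ (mul_mem (h.le h.i_mem) (mul_mem htG htG)) ?_ ?_
      · simp only [mul_assoc, hti]; rw [← mul_assoc t i t, hti, mul_assoc]
      · have e1 : t * (t * j) = i * i * j * t * t := by
          rw [htj, ← mul_assoc, ← mul_assoc, hti, mul_assoc i t j, htj]; group
        rw [mul_assoc, mul_assoc, e1, ← mul_assoc j i, h.j_mul_i, h.i_sq]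
        simp [mul_assoc]
    have hρ : ∃ ρ : ℚ, c * c = ρ • 1 := by
      have hv : ∀ y, i * (t * t) = y → i.1 * (t.1 * t.1) = y.1 := fun y hy =>
        congrArg Units.val hy
      rcases hs with hs | hs
      · exact ⟨-2⁻¹, by rw [hcc, hv _ hs]; rfl⟩
      · refine ⟨2⁻¹, by rw [hcc, hv _ hs, Units.val_neg, Units.val_one]; module⟩
    obtain ⟨ρ, hρ⟩ := hρ
    refine ⟨c, ρ, hci, hcj, hρ, fun g hg => ?_⟩
    obtain ⟨u, huG, hur, hui, huj | huj⟩ := h.exists_mul_commute hg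
    · exact Or.inl (hcomm g u hur (hC _ (mul_mem huG hg) hui huj))
    · right
      have hz : t⁻¹ * (u * g) = 1 ∨ t⁻¹ * (u * g) = -1 := by
        refine hC _ (mul_mem (inv_mem htG) (mul_mem huG hg)) ?_ ?_
        · rw [mul_assoc, hui, inv_mul_eq_iff_eq_mul, ← mul_assoc t, hti]; group
        · rw [mul_assoc, huj, inv_mul_eq_iff_eq_mul, ← mul_assoc t, htj]; group
      have key : ∀ y, t⁻¹ * (u * g) = y → g = u⁻¹ * (t * y) := fun y hy => by
        rw [← hy]; group
      rcases hz with hz | hz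
      · refine ⟨(u⁻¹).1 * (1 + i.1), mul_mem (hinv u hur) (add_mem (one_mem _) hir), ?_⟩
        rw [key _ hz, mul_one, Units.val_mul, htc, mul_assoc]
      · refine ⟨-((u⁻¹).1 * (1 + i.1)), neg_mem (mul_mem (hinv u hur)
          (add_mem (one_mem _) hir)), ?_⟩
        rw [key _ hz, mul_neg, mul_one, mul_neg, Units.val_neg, Units.val_mul, htc, neg_mul,
          mul_assoc]
  · refine ⟨1, 1, Commute.one_left _, Commute.one_left _, by simp, fun g hg => Or.inl ?_⟩
    obtain ⟨u, huG, hur, hui, huj | huj⟩ := h.exists_mul_commute hg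
    · exact hcomm g u hur (hC _ (mul_mem huG hg) hui huj)
    · exact absurd ⟨u * g, mul_mem huG hg, hui, huj⟩ ht

open scoped Quaternion in
/-- The centralizer of `i` and `j` in `G` is not `{±1}`. -/
theorem not_centralizer_le
    (hC : ∀ c ∈ G, c * i = i * c → c * j = j * c → c = 1 ∨ c = -1) : False := by
  obtain ⟨c, ρ, hci, hcj, hc, hG⟩ := h.exists_generator hC
  have hcq := commute_quatHom h.val_i_sq h.val_j_sq h.val_j_mul_i hci hcj
  by_cases hv : ∀ a, (Pi.single (Sum.inl 0) 1 : Fin 4 ⊕ Fin 4 → ℚ) ᵥ* c ≠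
      Pi.single (Sum.inl 0) 1 ᵥ* quatHom h.val_i_sq h.val_j_sq h.val_j_mul_i a
  · obtain ⟨X, hX, hXq, hXc⟩ := exists_complex_structure (by simp) h.val_i_sq h.val_j_sq
      h.val_j_mul_i hci hcj hc (by simp) hv
    refine h.no_complex_structure hX fun g hg => ?_
    rcases hG g hg with ⟨a, ha⟩ | ⟨_, ⟨a, rfl⟩, hac⟩
    · have ha' : quatHom h.val_i_sq h.val_j_sq h.val_j_mul_i a = g.1 := ha
      rw [← ha']; exact hXq a
    · rw [hac]; exact (hXq a).mul_right hXc
  · push Not at hv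
    obtain ⟨b, hb⟩ := hv
    obtain ⟨v, hv⟩ : ∃ v : Fin 4 ⊕ Fin 4 → ℚ, v = Pi.single (Sum.inl 0) 1 := ⟨_, rfl⟩
    obtain ⟨f, hf⟩ : ∃ f, f = quatHom h.val_i_sq h.val_j_sq h.val_j_mul_i := ⟨_, rfl⟩
    rw [← hf] at hb hcq hG
    rw [← hv] at hb
    let P : ℍ[ℚ] →ₗ[ℚ] Fin 4 ⊕ Fin 4 → ℚ :=
      { toFun := fun a => v ᵥ* f a
        map_add' := fun a b => by rw [map_add, Matrix.vecMul_add]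
        map_smul' := fun r a => by rw [map_smul, Matrix.vecMul_smul, RingHom.id_apply] }
    have hP : ∀ a, P a = v ᵥ* f a := fun _ => rfl
    have hd : ∀ a d, P a ᵥ* f d = P (a * d) := fun a d => by
      rw [hP, hP, vecMul_vecMul, map_mul]
    have hPc : ∀ a, P a ᵥ* c = P (b * a) := fun a => by
      rw [hP, vecMul_vecMul, ← (hcq a).eq, ← vecMul_vecMul, hb, ← hP, hd]
    have hinv : IsInvariantSubspace G (LinearMap.range P) := by
      rintro g hg _ ⟨a, rfl⟩
      rcases hG g hg with ⟨d, hd'⟩ | ⟨_, ⟨d, rfl⟩, hac⟩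
      · rw [← show f d = g.1 from hd', hd]; exact ⟨_, rfl⟩
      · rw [hac, ← vecMul_vecMul]
        change P a ᵥ* f d ᵥ* c ∈ _
        rw [hd, hPc]; exact ⟨_, rfl⟩
    rcases h.irreducible (LinearMap.range P) hinv with hbot | htop
    · have h1 : P 1 = 0 := by rw [LinearMap.range_eq_bot.1 hbot]; rfl
      rw [hP, map_one, vecMul_one, hv] at h1
      simp at h1
    · have : Module.Finite ℚ ℍ[ℚ] := Module.finite_of_finrank_pos (by
        rw [Quaternion.finrank_eq_four]; norm_num)
      have hle := LinearMap.finrank_range_le P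
      rw [htop, finrank_top, Quaternion.finrank_eq_four, Module.finrank_fintype_fun_eq_card] at hle
      simp at hle

end HasQuaternionFitting

section SkewMatrix

variable {n : Type*} [Fintype n] [DecidableEq n] {F i j X : Matrix n n ℚ}

theorem trace_eq_zero_of_skew {x : Matrix n n ℚ} (hF : IsUnit F) (hx : x * F = -(F * xᵀ)) :
    x.trace = 0 := by
  obtain ⟨F, rfl⟩ := hF
  have h1 : x = -(F.1 * xᵀ * F⁻¹.1) := by
    rw [← neg_mul, ← hx, Units.mul_inv_cancel_right]
  have h2 := congrArg Matrix.trace h1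
  rw [Matrix.trace_neg, Matrix.trace_mul_comm, Units.inv_mul_cancel_left,
    Matrix.trace_transpose] at h2
  exact self_eq_neg.1 h2

theorem exists_adjoint (hF : IsUnit F) (hFt : Fᵀ = F) (a : Matrix n n ℚ) :
    ∃ b, b * F = F * aᵀ ∧ a * F = F * bᵀ ∧
      ∀ x, x * F = -(F * xᵀ) → Commute x a → Commute x b := by
  obtain ⟨F, rfl⟩ := hF
  have h1 : F.1 * aᵀ * F⁻¹.1 * F.1 = F.1 * aᵀ := Units.inv_mul_cancel_right _ _
  refine ⟨F.1 * aᵀ * F⁻¹.1, h1, ?_, fun x hx hxa => ?_⟩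
  · have := congrArg Matrix.transpose h1
    rw [Matrix.transpose_mul, Matrix.transpose_mul F.1, Matrix.transpose_transpose, hFt] at this
    exact this.symm
  · refine (Units.mul_left_inj F).1 ?_
    rw [mul_assoc x, h1, ← mul_assoc, hx, neg_mul, mul_assoc, ← Matrix.transpose_mul, ← hxa.eq,
      Matrix.transpose_mul, mul_assoc, hx, mul_neg, ← mul_assoc, ← mul_assoc, h1, mul_assoc]

omit [DecidableEq n] in
theorem hermitian_of_skew_mul_skew {x y : Matrix n n ℚ} (hx : x * F = -(F * xᵀ))
    (hy : y * F = -(F * yᵀ)) (hxy : Commute x y) : x * y * F = F * (x * y)ᵀ := by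
  rw [mul_assoc, hy, mul_neg, ← mul_assoc, hx, neg_mul, neg_neg, mul_assoc,
    ← Matrix.transpose_mul, hxy.eq]

omit [DecidableEq n] in
theorem skew_of_skew_mul_hermitian {x y : Matrix n n ℚ} (hx : x * F = -(F * xᵀ))
    (hy : y * F = F * yᵀ) (hxy : Commute x y) : x * y * F = -(F * (x * y)ᵀ) := by
  rw [mul_assoc, hy, ← mul_assoc, hx, neg_mul, mul_assoc, ← Matrix.transpose_mul, hxy.eq]

theorem inv_val_mul_form {g : GL n ℚ} (hg : g.1 * F * g.1ᵀ = F) : g⁻¹.1 * F = F * g.1ᵀ := by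
  conv_lhs => rw [← hg, ← mul_assoc, ← mul_assoc, Units.inv_mul, one_mul]

theorem add_inv_hermitian {g : GL n ℚ} (hFt : Fᵀ = F) (hg : g.1 * F * g.1ᵀ = F) :
    (g.1 + g⁻¹.1) * F = F * (g.1 + g⁻¹.1)ᵀ := by
  have e := congrArg Matrix.transpose (inv_val_mul_form hg)
  rw [Matrix.transpose_mul, Matrix.transpose_mul F, Matrix.transpose_transpose, hFt] at e
  rw [add_mul, inv_val_mul_form hg, ← e, Matrix.transpose_add, mul_add, add_comm]

theorem sub_inv_skew {g : GL n ℚ} (hFt : Fᵀ = F) (hg : g.1 * F * g.1ᵀ = F) :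
    (g.1 - g⁻¹.1) * F = -(F * (g.1 - g⁻¹.1)ᵀ) := by
  have e := congrArg Matrix.transpose (inv_val_mul_form hg)
  rw [Matrix.transpose_mul, Matrix.transpose_mul F, Matrix.transpose_transpose, hFt] at e
  rw [sub_mul, inv_val_mul_form hg, ← e, Matrix.transpose_sub, mul_sub, neg_sub]

namespace IsQuaternionPair

variable (h : IsQuaternionPair F i j)
include h

theorem isUnit_form : IsUnit F := isUnit_of_form_pos h.pos

theorem exists_hermitian_mul_add_mul (hn : Fintype.card n = 8) {b c : Matrix n n ℚ}
    (hb : b * F = F * bᵀ) (hbi : Commute b i) (hbj : Commute b j) (hc : c * F = F * cᵀ)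
    (hci : Commute c i) (hcj : Commute c j) :
    ∃ ν : ℚ, b * c + c * b = (b.trace / 4) • c + (c.trace / 4) • b - ν • 1 := by
  obtain ⟨ν₁, h₁⟩ := h.exists_hermitian_sq hn hb hbi hbj
  obtain ⟨ν₂, h₂⟩ := h.exists_hermitian_sq hn hc hci hcj
  obtain ⟨ν₃, h₃⟩ := h.exists_hermitian_sq hn (b := b + c)
    (by rw [add_mul, hb, hc, Matrix.transpose_add, mul_add]) (hbi.add_left hci) (hbj.add_left hcj)
  refine ⟨ν₃ - ν₁ - ν₂, ?_⟩
  have h₄ : b * c + c * b = (b + c) * (b + c) - b * b - c * c := by noncomm_ring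
  rw [h₄, h₁, h₂, h₃, Matrix.trace_add]
  module

/-- Every matrix over `ℚ(X)` is the sum of a Hermitian matrix and `X` times a Hermitian matrix. -/
theorem exists_hermitian_add_skew (hXF : X * F = -(F * Xᵀ)) (hXi : Commute X i)
    (hXj : Commute X j) {r : ℚ} (hr : r ≠ 0) (hXX : X * X = r • 1) {a : Matrix n n ℚ}
    (hai : Commute a i) (haj : Commute a j) (haX : Commute a X) :
    ∃ b c, a = b + X * c ∧ (b * F = F * bᵀ ∧ Commute b i ∧ Commute b j ∧ Commute b X) ∧
      (c * F = F * cᵀ ∧ Commute c i ∧ Commute c j ∧ Commute c X) := by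
  obtain ⟨s, hs, hs', hsc⟩ := exists_adjoint h.isUnit_form h.symm a
  have hsi := (hsc i h.i_adj hai.symm).symm
  have hsj := (hsc j h.j_adj haj.symm).symm
  have hsX := (hsc X hXF haX.symm).symm
  have hd : (a - s) * F = -(F * (a - s)ᵀ) := by
    rw [sub_mul, hs, hs', Matrix.transpose_sub, mul_sub, neg_sub]
  refine ⟨(2⁻¹ : ℚ) • (a + s), (2⁻¹ * r⁻¹ : ℚ) • (X * (a - s)), ?_,
    ⟨?_, ?_, ?_, ?_⟩, ?_, ?_, ?_, ?_⟩
  · rw [mul_smul_comm, ← mul_assoc, hXX, smul_one_mul, smul_smul, mul_assoc, inv_mul_cancel₀ hr]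
    module
  · rw [smul_mul_assoc, add_mul, hs, hs', Matrix.transpose_smul, mul_smul_comm,
      Matrix.transpose_add, mul_add, add_comm]
  · exact (hai.add_left hsi).smul_left _
  · exact (haj.add_left hsj).smul_left _
  · exact (haX.add_left hsX).smul_left _
  · rw [smul_mul_assoc, hermitian_of_skew_mul_skew hXF hd (haX.sub_left hsX).symm,
      Matrix.transpose_smul, mul_smul_comm]
  · exact (hXi.mul_left (hai.sub_left hsi)).smul_left _
  · exact (hXj.mul_left (haj.sub_left hsj)).smul_left _
  · exact ((Commute.refl X).mul_left (haX.sub_left hsX)).smul_left _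

/-- The reduced characteristic polynomial over `ℚ(X)`. -/
theorem exists_reducedNorm (hn : Fintype.card n = 8) (hXF : X * F = -(F * Xᵀ)) (hXi : Commute X i)
    (hXj : Commute X j) {r : ℚ} (hr : r ≠ 0) (hXX : X * X = r • 1) {a : Matrix n n ℚ}
    (hai : Commute a i) (haj : Commute a j) (haX : Commute a X) :
    ∃ μ ν : ℚ, ((a.trace / 4) • 1 + ((X * a).trace / (4 * r)) • X) * a - a * a =
      μ • 1 + ν • X := by
  obtain ⟨b, c, rfl, ⟨hb, hbi, hbj, hbX⟩, hc, hci, hcj, hcX⟩ :=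
    h.exists_hermitian_add_skew hXF hXi hXj hr hXX hai haj haX
  obtain ⟨ν₁, h₁⟩ := h.exists_hermitian_sq hn hb hbi hbj
  obtain ⟨ν₂, h₂⟩ := h.exists_hermitian_sq hn hc hci hcj
  obtain ⟨ν₃, h₃⟩ := h.exists_hermitian_mul_add_mul hn hb hbi hbj hc hci hcj
  have e1 : (X * c).trace = 0 := trace_eq_zero_of_skew h.isUnit_form
    (skew_of_skew_mul_hermitian hXF hc hcX.symm)
  have e2 : (X * b).trace = 0 := trace_eq_zero_of_skew h.isUnit_form
    (skew_of_skew_mul_hermitian hXF hb hbX.symm)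
  have e3 : (X * (X * c)).trace = r * c.trace := by
    rw [← mul_assoc, hXX, smul_one_mul, Matrix.trace_smul, smul_eq_mul]
  rw [Matrix.trace_add, mul_add X, Matrix.trace_add, e1, e2, e3, add_zero, zero_add,
    mul_comm 4 r, mul_div_mul_left _ _ hr]
  have e4 : (b + X * c) * (b + X * c) = b * b + X * (b * c + c * b) + r • (c * c) := by
    have e5 : X * c * (X * c) = r • (c * c) := by
      rw [mul_assoc, ← mul_assoc c, hcX.eq, mul_assoc X, ← mul_assoc X, hXX, smul_one_mul]
    have e6 : b * (X * c) = X * (b * c) := by rw [← mul_assoc, hbX.eq, mul_assoc]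
    rw [add_mul, mul_add, mul_add, e5, e6, mul_assoc X c b, mul_add]
    abel
  have e7 : X * (X * c) = r • c := by rw [← mul_assoc, hXX, smul_one_mul]
  refine ⟨ν₁ + r * ν₂, ν₃, ?_⟩
  rw [e4, h₁, h₂, h₃]
  simp only [add_mul, mul_add, mul_sub, smul_mul_assoc, mul_smul_comm, one_mul, mul_one, e7]
  module

/-- A finite unitary group over `ℚ(X)`, for `X²` rational, is solvable. -/
theorem isSolvable_of_sq_rational (hn : Fintype.card n = 8) (hXF : X * F = -(F * Xᵀ))
    (hXi : Commute X i) (hXj : Commute X j) {r : ℚ} (hr : r ≠ 0) (hXX : X * X = r • 1)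
    {C : Subgroup (GL n ℚ)} [Finite C]
    (hC : ∀ g ∈ C, Commute g.1 i ∧ Commute g.1 j ∧ Commute g.1 X ∧ g.1 * F * g.1ᵀ = F) :
    Group.IsSolvable C := by
  let A := Subalgebra.centralizer ℚ ({i, j, X} : Set (Matrix n n ℚ))
  have hA : ∀ x, x ∈ A ↔ Commute x i ∧ Commute x j ∧ Commute x X := fun x => by
    simp only [A, Subalgebra.mem_centralizer_iff, Set.mem_insert_iff, Set.mem_singleton_iff,
      forall_eq_or_imp, forall_eq]
    exact and_congr eq_comm (and_congr eq_comm eq_comm)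
  let x : A := ⟨X, (hA X).2 ⟨hXi, hXj, Commute.refl X⟩⟩
  have hx : ∀ a : A, x * a = a * x := fun a => Subtype.ext ((hA _).1 a.2).2.2.eq.symm
  have hxx : x * x = r • 1 := Subtype.ext hXX
  have hX0 : X.trace = 0 := trace_eq_zero_of_skew h.isUnit_form hXF
  have hXXt : (X * X).trace = 8 * r := by
    rw [hXX, Matrix.trace_smul, Matrix.trace_one, hn, smul_eq_mul]; push_cast; ring
  let f : C →* A :=
    { toFun := fun g => ⟨g.1.1, (hA _).2 ⟨(hC g g.2).1, (hC g g.2).2.1, (hC g g.2).2.2.1⟩⟩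
      map_one' := rfl
      map_mul' := fun _ _ => rfl }
  let t : A →+ A :=
    { toFun := fun a => (a.1.trace / 4) • 1 + ((X * a.1).trace / (4 * r)) • x
      map_zero' := by simp
      map_add' := fun a b => by
        simp only [AddMemClass.coe_add, mul_add, Matrix.trace_add]
        module }
  have ht : ∀ a, t a = (a.1.trace / 4) • 1 + ((X * a.1).trace / (4 * r)) • x := fun _ => rfl
  have htc : ∀ a b, t a * b = b * t a := fun a b => by
    simp only [ht, add_mul, mul_add, smul_mul_assoc, mul_smul_comm, one_mul, mul_one, hx b]
  have hlin : ∀ (p q : ℚ) (a : A), t (p • a + q • (x * a)) =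
      (p • 1 + q • x) * t a := fun p q a => by
    have e1 : (p • a + q • (x * a)).1 = p • a.1 + q • (X * a.1) := rfl
    have e2 : X * (X * a.1) = r • a.1 := by rw [← mul_assoc, hXX, smul_one_mul]
    rw [ht, ht, e1, mul_add X, mul_smul_comm, mul_smul_comm, e2]
    simp only [Matrix.trace_add, Matrix.trace_smul, add_mul, mul_add, smul_mul_assoc,
      mul_smul_comm, one_mul, mul_one, hxx, smul_eq_mul]
    have e3 : q * (r * a.1.trace) / (4 * r) = q * (a.1.trace / 4) := by field_simp
    have e4 : q * ((X * a.1).trace / (4 * r)) * r = q * (X * a.1).trace / 4 := by field_simp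
    match_scalars
    · linear_combination -e4
    · rw [add_div, e3]; ring
  have ht1 : t 1 = 2 := by
    have e1 : (1 : A).1 = 1 := rfl
    rw [ht, e1, mul_one, hX0, Matrix.trace_one, hn]
    norm_num
    rw [two_smul, one_add_one_eq_two]
  have hnorm : ∀ a : A, ∃ μ ν : ℚ, t a * a - a * a = μ • 1 + ν • x := fun a => by
    obtain ⟨h1, h2, h3⟩ := (hA _).1 a.2
    obtain ⟨μ, ν, e⟩ := h.exists_reducedNorm hn hXF hXi hXj hr hXX h1 h2 h3
    exact ⟨μ, ν, Subtype.ext e⟩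
  have : Nonempty n := Fintype.card_pos_iff.1 (by rw [hn]; norm_num)
  refine isSolvable_of_reducedTrace (f := f) (t := t) ?_ htc ?_ ?_ ht1 ?_ ?_ ?_
  · intro g g' hg
    exact Subtype.ext (Units.ext (congrArg Subtype.val hg))
  · intro a b
    have e1 : (X * (a.1 * b.1)).trace = (X * (b.1 * a.1)).trace := by
      rw [← mul_assoc, ← ((hA _).1 a.2).2.2.eq, mul_assoc, Matrix.trace_mul_comm, mul_assoc]
    simp only [ht]
    change ((a.1 * b.1).trace / 4) • (1 : A) + ((X * (a.1 * b.1)).trace / (4 * r)) • x =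
      ((b.1 * a.1).trace / 4) • 1 + ((X * (b.1 * a.1)).trace / (4 * r)) • x
    rw [e1, Matrix.trace_mul_comm]
  · intro a b
    rw [ht a, add_mul, smul_mul_assoc, smul_mul_assoc, one_mul, hlin]
  · intro a b
    obtain ⟨μ, ν, e⟩ := hnorm a
    rw [e]
    simp only [add_mul, mul_add, smul_mul_assoc, mul_smul_comm, one_mul, mul_one, hx b]
  · intro a
    obtain ⟨μ, ν, e⟩ := hnorm a
    have e1 := hlin μ ν 1
    rw [mul_one, ht1] at e1
    rw [e, e1, mul_two, two_mul]
  · intro g hg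
    obtain ⟨hgi, hgj, hgX, hgF⟩ := hC g g.2
    have hgc := (hC _ (g⁻¹).2).2.2.1
    have e1 := trace_eq_zero_of_skew h.isUnit_form
      (skew_of_skew_mul_hermitian hXF (add_inv_hermitian h.symm hgF) (hgX.add_left hgc).symm)
    have e2 : g.1.1 + g.1⁻¹.1 = (t (f g)).1 := congrArg Subtype.val hg
    have e3 : (t (f g)).1 = (g.1.1.trace / 4) • (1 : Matrix n n ℚ) +
      ((X * g.1.1).trace / (4 * r)) • X := rfl
    rw [e2, e3, mul_add, mul_smul_comm, mul_smul_comm, mul_one, Matrix.trace_add,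
      Matrix.trace_smul, Matrix.trace_smul, hX0, hXXt, smul_zero, zero_add, smul_eq_mul,
      mul_eq_zero] at e1
    refine ⟨g.1.1.trace / 4, ?_⟩
    rw [hg, ht, show (X * (f g).1).trace / (4 * r) = 0 from
      e1.resolve_right (mul_ne_zero (by norm_num) hr), zero_smul, add_zero]
    rfl

/-- A unitary group over `ℚ(X)`, for `X²` irrational, is commutative. -/
theorem isSolvable_of_sq_irrational (hn : Fintype.card n = 8) (hXF : X * F = -(F * Xᵀ))
    (hXi : Commute X i) (hXj : Commute X j) (hXu : IsUnit X)
    (hu : IsUnit ((2 : ℚ) • (X * X) - ((X * X).trace / 4) • 1)) {C : Subgroup (GL n ℚ)}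
    (hC : ∀ g ∈ C, Commute g.1 i ∧ Commute g.1 j ∧ Commute g.1 X ∧ g.1 * F * g.1ᵀ = F) :
    Group.IsSolvable C := by
  have hXX := hermitian_of_skew_mul_skew hXF hXF (Commute.refl X)
  have key : ∀ z, z * F = F * zᵀ → Commute z i → Commute z j → Commute z X →
      ∀ c, Commute c X → c * z = z * c := by
    intro z hz hzi hzj hzX c hcX
    obtain ⟨ν, e⟩ := h.exists_hermitian_mul_add_mul hn hXX (hXi.mul_left hXi) (hXj.mul_left hXj)
      hz hzi hzj
    have e1 : ((2 : ℚ) • (X * X) - ((X * X).trace / 4) • 1) * z =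
        (z.trace / 4) • (X * X) - ν • 1 := by
      have e2 : z * (X * X) = X * X * z := (hzX.mul_right hzX).eq
      rw [e2, ← two_smul ℚ] at e
      rw [sub_mul, smul_mul_assoc, e, smul_one_mul]
      module
    have e3 : Commute c ((z.trace / 4) • (X * X) - ν • 1) :=
      ((hcX.mul_right hcX).smul_right _).sub_right ((Commute.one_right _).smul_right _)
    have e4 : Commute c ((2 : ℚ) • (X * X) - ((X * X).trace / 4) • 1) :=
      ((hcX.mul_right hcX).smul_right _).sub_right ((Commute.one_right _).smul_right _)
    refine hu.mul_left_cancel ?_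
    rw [← mul_assoc, ← e4.eq, mul_assoc, ← mul_assoc _ z, e1, e3.eq]
  refine Group.isSolvable_of_comm fun g g' => Subtype.ext (Units.ext ?_)
  obtain ⟨hgi, hgj, hgX, hgF⟩ := hC g g.2
  obtain ⟨hgi', hgj', hgX', -⟩ := hC _ (inv_mem g.2)
  have hcX := (hC g' g'.2).2.2.1
  have e1 := key _ (add_inv_hermitian h.symm hgF) (hgi.add_left hgi') (hgj.add_left hgj')
    (hgX.add_left hgX') _ hcX
  have e2 := key _ (hermitian_of_skew_mul_skew hXF (sub_inv_skew h.symm hgF)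
    (hgX.sub_left hgX').symm) (hXi.mul_left (hgi.sub_left hgi')) (hXj.mul_left (hgj.sub_left hgj'))
    ((Commute.refl X).mul_left (hgX.sub_left hgX')) _ hcX
  have e3 : g'.1.1 * (g.1.1 - g.1⁻¹.1) = (g.1.1 - g.1⁻¹.1) * g'.1.1 := by
    refine hXu.mul_left_cancel ?_
    rw [← mul_assoc, ← hcX.eq, mul_assoc, e2, mul_assoc]
  have e4 : g.1.1 = (2⁻¹ : ℚ) • (g.1.1 + g.1⁻¹.1) + (2⁻¹ : ℚ) • (g.1.1 - g.1⁻¹.1) := by module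
  change g.1.1 * g'.1.1 = g'.1.1 * g.1.1
  rw [e4, add_mul, mul_add, smul_mul_assoc, smul_mul_assoc, mul_smul_comm, mul_smul_comm, e1, e3]

end IsQuaternionPair

end SkewMatrix

namespace HasQuaternionFitting

variable {G N : Subgroup (GL (Fin 4 ⊕ Fin 4) ℚ)} {i j : GL (Fin 4 ⊕ Fin 4) ℚ}
  (h : HasQuaternionFitting G N i j)
include h

theorem isQuaternionPair {F : Matrix (Fin 4 ⊕ Fin 4) (Fin 4 ⊕ Fin 4) ℚ} (hF : Fᵀ = F)
    (hFp : ∀ x, x ≠ 0 → 0 < Matrix.toBilin' F x x) (hFG : ∀ g ∈ G, g.1 * F * g.1ᵀ = F) :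
    IsQuaternionPair F i.1 j.1 where
  symm := hF
  pos := hFp
  i_sq := h.val_i_sq
  j_sq := h.val_j_sq
  j_mul_i := h.val_j_mul_i
  i_adj := mul_form_eq_neg (hFG i (h.le h.i_mem)) h.val_i_sq
  j_adj := mul_form_eq_neg (hFG j (h.le h.j_mem)) h.val_j_sq

theorem isSolvable_of_centralizes {C : Subgroup (GL (Fin 4 ⊕ Fin 4) ℚ)} (hCG : C ≤ G)
    (hCi : ∀ c ∈ C, c * i = i * c) (hCj : ∀ c ∈ C, c * j = j * c) : Group.IsSolvable C := by
  obtain ⟨F, hF, hFp, hFG⟩ := exists_invariant_form h.finite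
  have hq := h.isQuaternionPair hF hFp hFG
  obtain ⟨A, hA, hAu, hAG⟩ := h.symplectic
  obtain ⟨F, rfl⟩ := hq.isUnit_form
  obtain ⟨X, hX⟩ : ∃ X, X = A * F⁻¹.1 := ⟨_, rfl⟩
  have hXF : X * F.1 = A := by rw [hX, Units.inv_mul_cancel_right]
  have hXu : IsUnit X := by rw [hX]; exact hAu.mul (Units.isUnit _)
  have hXG : ∀ g ∈ G, Commute X g.1 := by
    intro g hg
    have e : g.1 * F.1 = F.1 * g⁻¹.1ᵀ := by
      have := inv_val_mul_form (hFG g⁻¹ (inv_mem hg))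
      rwa [inv_inv] at this
    have eA : g.1 * A = A * g⁻¹.1ᵀ := by
      have := inv_val_mul_form (hAG g⁻¹ (inv_mem hg))
      rwa [inv_inv] at this
    refine (Units.mul_left_inj F).1 ?_
    rw [mul_assoc, e, ← mul_assoc, hXF, mul_assoc, hXF, eA]
  have hXF' : X * F.1 = -(F.1 * Xᵀ) := by
    have := congrArg Matrix.transpose hXF
    rw [Matrix.transpose_mul, hF, hA, ← hXF] at this
    rw [this, neg_neg]
  have hXi := hXG i (h.le h.i_mem)
  have hXj := hXG j (h.le h.j_mem)
  have hC : ∀ g ∈ C, Commute g.1 i.1 ∧ Commute g.1 j.1 ∧ Commute g.1 X ∧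
      g.1 * F.1 * g.1ᵀ = F.1 := fun g hg =>
    ⟨congrArg Units.val (hCi g hg), congrArg Units.val (hCj g hg), (hXG g (hCG hg)).symm,
      hFG g (hCG hg)⟩
  by_cases hY : (2 : ℚ) • (X * X) - ((X * X).trace / 4) • 1 = 0
  · have : Finite C := h.finite.subset hCG
    have hXX : X * X = ((X * X).trace / 8) • 1 := by
      have e := sub_eq_zero.1 hY
      calc X * X = (2⁻¹ : ℚ) • ((2 : ℚ) • (X * X)) := by module
        _ = _ := by rw [e]; module
    refine hq.isSolvable_of_sq_rational (by simp) hXF' hXi hXj ?_ hXX hC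
    intro hr
    rw [hr, zero_smul] at hXX
    exact (hXu.mul hXu).ne_zero hXX
  · refine hq.isSolvable_of_sq_irrational (by simp) hXF' hXi hXj hXu
      (h.irreducible.isUnit_of_commute hY fun g hg => ?_) hC
    exact (((hXG g hg).mul_left (hXG g hg)).smul_left _).sub_left
      ((Commute.one_left _).smul_left _)

theorem eq_one_or_eq_neg_one_of_centralizes {c : GL (Fin 4 ⊕ Fin 4) ℚ} (hc : c ∈ G)
    (hci : c * i = i * c) (hcj : c * j = j * c) : c = 1 ∨ c = -1 := by
  have hN : ∀ y : GL (Fin 4 ⊕ Fin 4) ℚ, y * i = i * y → y * j = j * y →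
      ∀ x ∈ N, y * x = x * y := by
    intro y hyi hyj x hx
    have hi : Commute y i := hyi
    have hj : Commute y j := hyj
    rcases h.mem x hx with rfl | rfl | rfl | rfl | rfl | rfl | rfl | rfl
    · exact (Commute.one_right y).eq
    · exact ((Commute.one_right y).neg_right).eq
    · exact hi.eq
    · exact hi.neg_right.eq
    · exact hj.eq
    · exact hj.neg_right.eq
    · exact (hi.mul_right hj).eq
    · exact (hi.mul_right hj).neg_right.eq
  let C : Subgroup G := (Subgroup.centralizer (N : Set (GL (Fin 4 ⊕ Fin 4) ℚ))).subgroupOf G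
  have hCm : ∀ y : G, y ∈ C ↔ ∀ x ∈ N, y.1 * x = x * y.1 := fun y => by
    simp only [C, Subgroup.mem_subgroupOf, Subgroup.mem_centralizer_iff, SetLike.mem_coe, eq_comm]
  have hCn : C.Normal := by
    refine ⟨fun y hy g => (hCm _).2 fun x hx => ?_⟩
    have e := (hCm y).1 hy _ (h.normal _ (inv_mem g.2) x hx)
    change g.1 * y.1 * g.1⁻¹ * x = x * (g.1 * y.1 * g.1⁻¹)
    rw [inv_inv] at e
    calc _ = g.1 * (y.1 * (g.1⁻¹ * x * g.1)) * g.1⁻¹ := by group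
      _ = _ := by rw [e]; group
  have hCs : Group.IsSolvable C := by
    have := h.isSolvable_of_centralizes (Subgroup.map_subtype_le C)
      (by rintro _ ⟨y, hy, rfl⟩; exact (hCm y).1 hy i h.i_mem)
      (by rintro _ ⟨y, hy, rfl⟩; exact (hCm y).1 hy j h.j_mem)
    exact Group.isSolvable_of_isSolvable_injective
      (f := (C.equivMapOfInjective G.subtype G.subtype_injective).toMonoidHom)
      (C.equivMapOfInjective G.subtype G.subtype_injective).injective
  have hle : C ≤ (Subgroup.zpowers (-1 : GL (Fin 4 ⊕ Fin 4) ℚ)).subgroupOf G := by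
    refine Subgroup.le_of_isSolvable_of_isNilpotent_le ?_ fun M hM hMC hMn x hx => ?_
    · rintro z ⟨k, hk⟩ y -
      refine Subtype.ext ?_
      have hz : z.1 = (-1) ^ k := hk.symm
      change y.1 * z.1 = z.1 * y.1
      rw [hz]
      exact (((Commute.one_right y.1).neg_right).zpow_right k).eq
    · have hxN : x.1 ∈ N := by
        refine h.nilpotent_le (M.map G.subtype) (Subgroup.map_subtype_le M) ?_ ?_ ⟨x, hx, rfl⟩
        · rintro g hg _ ⟨y, hy, rfl⟩
          exact ⟨_, hM.conj_mem y hy ⟨g, hg⟩, rfl⟩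
        · exact Group.nilpotent_of_mulEquiv
            (M.equivMapOfInjective G.subtype G.subtype_injective)
      have hxC := (hCm x).1 (hMC hx)
      rcases h.eq_one_or_eq_neg_one hxN (hxC i h.i_mem) (hxC j h.j_mem) with e | e
      · exact ⟨0, by rw [G.subtype_apply, e]; rfl⟩
      · exact ⟨1, by rw [G.subtype_apply, e]; exact zpow_one _⟩
  obtain ⟨k, hk⟩ := hle ((hCm ⟨c, hc⟩).2 (hN c hci hcj))
  have hk' : (-1) ^ k = c := hk
  rw [← hk']
  rcases Int.even_or_odd k with hk | hk
  · exact Or.inl hk.neg_one_zpow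
  · exact Or.inr hk.neg_one_zpow

end HasQuaternionFitting

/-- There is no s.p.i.m.f. subgroup of `Sp_8(ℚ)` whose Fitting subgroup is isomorphic to
the quaternion group `Q_8`. -/
theorem no_spimf_sp8_fitting_Q8 :
    ¬ ∃ (G : Subgroup (GL (Fin 4 ⊕ Fin 4) ℚ)) (N : Subgroup G),
      (∀ g ∈ G, (g : Matrix (Fin 4 ⊕ Fin 4) (Fin 4 ⊕ Fin 4) ℚ) ∈
        Matrix.symplecticGroup (Fin 4) ℚ) ∧
      IsSPIMF G ∧
      N.Normal ∧ Group.IsNilpotent N ∧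
      (∀ N' : Subgroup G, N'.Normal → Group.IsNilpotent N' → N' ≤ N) ∧
      Nonempty (N ≃* QuaternionGroup 2) := by
  rintro ⟨G, N, -, hG, hN, -, hF, ⟨e⟩⟩
  obtain ⟨i, j, h⟩ := hG.exists_hasQuaternionFitting hN hF e
  exact h.not_centralizer_le fun c hc hci hcj => h.eq_one_or_eq_neg_one_of_centralizes hc hci hcj
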